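/- In the coordinate transport setting, assume in addition that the matrix A(x) with entries V_{ab}(x) + Ŵ_{ab}(x) is positive definite for every x ∈ Ω. Define H_{ij}(x) := Tr[ A(x)⁻¹ · S_i(x) · (D²Φ(x))⁻¹ · S_j(x) ], where S_i(x) is the matrix with (a,b)-entry V_{iab}(x) − Ŵ_{iab}(x). Then at every x ∈ Ω the matrix with entries H_{ij} + 2 (Lg)_{ij} − Σ_{s,m} (V_{is} + Ŵ_{is}) Φ^{sm} g_{mj} − Σ_{s,m} (V_{js} + Ŵ_{js}) Φ^{sm} g_{mi} − Σ_{k,m} g_{ki} Φ^{km} g_{mj} is positive semidefinite, where Lg is the weighted tensor Laplacian of the Calabi tensor g. -/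

import Mathlib

noncomputable section
open scoped BigOperators
open Filter MeasureTheory

/-- Partial derivative `∂_i f`. -/
def pd {n : ℕ} (f : (Fin n → ℝ) → ℝ) (i : Fin n) : (Fin n → ℝ) → ℝ :=
  fun x => fderiv ℝ f x (Pi.single i 1)

/-- Second partial derivative `f_{ij}`. -/
def pd2 {n : ℕ} (f : (Fin n → ℝ) → ℝ) (i j : Fin n) : (Fin n → ℝ) → ℝ :=
  pd (pd f i) j

/-- Third partial derivative `f_{ijk}`. -/
def pd3 {n : ℕ} (f : (Fin n → ℝ) → ℝ) (i j k : Fin n) : (Fin n → ℝ) → ℝ :=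
  pd (pd2 f i j) k

/-- Fourth partial derivative `f_{ijkl}`. -/
def pd4 {n : ℕ} (f : (Fin n → ℝ) → ℝ) (i j k l : Fin n) : (Fin n → ℝ) → ℝ :=
  pd (pd3 f i j k) l

/-- Fifth partial derivative. -/
def pd5 {n : ℕ} (f : (Fin n → ℝ) → ℝ) (i j k l m : Fin n) : (Fin n → ℝ) → ℝ :=
  pd (pd4 f i j k l) m

/-- The Hessian matrix `D²Φ(x)`, with entries `Φ_{ij}(x)`. -/
def hess {n : ℕ} (Φ : (Fin n → ℝ) → ℝ) (x : Fin n → ℝ) : Matrix (Fin n) (Fin n) ℝ :=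
  Matrix.of fun i j => pd2 Φ i j x

/-- The inverse Hessian matrix, with entries `Φ^{ij}(x)`. -/
def ihess {n : ℕ} (Φ : (Fin n → ℝ) → ℝ) (x : Fin n → ℝ) : Matrix (Fin n) (Fin n) ℝ :=
  (hess Φ x)⁻¹

/-- The gradient `∇Φ(x)`. -/
def grad {n : ℕ} (Φ : (Fin n → ℝ) → ℝ) (x : Fin n → ℝ) : Fin n → ℝ :=
  fun i => pd Φ i x

/-- The Calabi tensor `g_{ij} = Σ Φ_{iab} Φ_{jcd} Φ^{ac} Φ^{bd}`. -/
def calabi {n : ℕ} (Φ : (Fin n → ℝ) → ℝ) (i j : Fin n) (x : Fin n → ℝ) : ℝ :=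
  ∑ a, ∑ b, ∑ c, ∑ d,
    pd3 Φ i a b x * pd3 Φ j c d x * ihess Φ x a c * ihess Φ x b d

/-- `W^i := (∂_i W)(∇Φ)`. -/
def Wop {n : ℕ} (Φ W : (Fin n → ℝ) → ℝ) (i : Fin n) (x : Fin n → ℝ) : ℝ :=
  pd W i (grad Φ x)

/-- `Ŵ_{ij} := Σ_{a,b} W^{ab} Φ_{ai} Φ_{bj}` where `W^{ab} = (∂²_{ab}W)(∇Φ)`. -/
def What2 {n : ℕ} (Φ W : (Fin n → ℝ) → ℝ) (i j : Fin n) (x : Fin n → ℝ) : ℝ :=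
  ∑ a, ∑ b, pd2 W a b (grad Φ x) * pd2 Φ a i x * pd2 Φ b j x

/-- `Ŵ_{ijk} := Σ_{a,b,c} W^{abc} Φ_{ai} Φ_{bj} Φ_{ck}` where `W^{abc} = (∂³_{abc}W)(∇Φ)`. -/
def What3 {n : ℕ} (Φ W : (Fin n → ℝ) → ℝ) (i j k : Fin n) (x : Fin n → ℝ) : ℝ :=
  ∑ a, ∑ b, ∑ c, pd3 W a b c (grad Φ x) * pd2 Φ a i x * pd2 Φ b j x * pd2 Φ c k x

/-- Christoffel symbols `Γ^k_{pq} = ½ Σ_m Φ^{km} Φ_{mpq}` of the Hessian metric. -/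
def Γh {n : ℕ} (Φ : (Fin n → ℝ) → ℝ) (k p q : Fin n) (x : Fin n → ℝ) : ℝ :=
  (1/2) * ∑ m, ihess Φ x k m * pd3 Φ m p q x

/-- Covariant derivative of a (0,1)-tensor: `(∇T)_{p i}`. -/
def covD1 {n : ℕ} (Φ : (Fin n → ℝ) → ℝ) (T : Fin n → (Fin n → ℝ) → ℝ)
    (p i : Fin n) (x : Fin n → ℝ) : ℝ :=
  pd (T i) p x - ∑ m, Γh Φ m p i x * T m x

/-- Covariant derivative of a (0,2)-tensor: `(∇T)_{p i j}`. -/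
def covD2 {n : ℕ} (Φ : (Fin n → ℝ) → ℝ) (T : Fin n → Fin n → (Fin n → ℝ) → ℝ)
    (p i j : Fin n) (x : Fin n → ℝ) : ℝ :=
  pd (T i j) p x - ∑ m, Γh Φ m p i x * T m j x - ∑ m, Γh Φ m p j x * T i m x

/-- Covariant derivative of a (0,3)-tensor: `(∇T)_{p i j k}`. -/
def covD3 {n : ℕ} (Φ : (Fin n → ℝ) → ℝ) (T : Fin n → Fin n → Fin n → (Fin n → ℝ) → ℝ)
    (p i j k : Fin n) (x : Fin n → ℝ) : ℝ :=
  pd (T i j k) p x - ∑ m, Γh Φ m p i x * T m j k x - ∑ m, Γh Φ m p j x * T i m k x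
    - ∑ m, Γh Φ m p k x * T i j m x

/-- Covariant derivative of a (0,4)-tensor: `(∇T)_{p i j k l}`. -/
def covD4 {n : ℕ} (Φ : (Fin n → ℝ) → ℝ)
    (T : Fin n → Fin n → Fin n → Fin n → (Fin n → ℝ) → ℝ)
    (p i j k l : Fin n) (x : Fin n → ℝ) : ℝ :=
  pd (T i j k l) p x - ∑ m, Γh Φ m p i x * T m j k l x - ∑ m, Γh Φ m p j x * T i m k l x
    - ∑ m, Γh Φ m p k x * T i j m l x - ∑ m, Γh Φ m p l x * T i j k m x

/-- Weighted tensor Laplacian of a (0,1)-tensor: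
`(LT)_i = Σ Φ^{pq}(∇∇T)_{pq i} − ½ Σ_p (Σ_m Φ^{pm} V_m + W^p)(∇T)_{p i}`. -/
def LT1 {n : ℕ} (Φ V W : (Fin n → ℝ) → ℝ) (T : Fin n → (Fin n → ℝ) → ℝ)
    (i : Fin n) (x : Fin n → ℝ) : ℝ :=
  (∑ p, ∑ q, ihess Φ x p q * covD2 Φ (covD1 Φ T) p q i x)
    - (1/2) * ∑ p, ((∑ m, ihess Φ x p m * pd V m x) + Wop Φ W p x) * covD1 Φ T p i x

/-- Weighted tensor Laplacian of a (0,2)-tensor. -/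
def LT2 {n : ℕ} (Φ V W : (Fin n → ℝ) → ℝ) (T : Fin n → Fin n → (Fin n → ℝ) → ℝ)
    (i j : Fin n) (x : Fin n → ℝ) : ℝ :=
  (∑ p, ∑ q, ihess Φ x p q * covD3 Φ (covD2 Φ T) p q i j x)
    - (1/2) * ∑ p, ((∑ m, ihess Φ x p m * pd V m x) + Wop Φ W p x) * covD2 Φ T p i j x

/-- Weighted tensor Laplacian of a (0,3)-tensor. -/
def LT3 {n : ℕ} (Φ V W : (Fin n → ℝ) → ℝ) (T : Fin n → Fin n → Fin n → (Fin n → ℝ) → ℝ)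
    (i j k : Fin n) (x : Fin n → ℝ) : ℝ :=
  (∑ p, ∑ q, ihess Φ x p q * covD4 Φ (covD3 Φ T) p q i j k x)
    - (1/2) * ∑ p, ((∑ m, ihess Φ x p m * pd V m x) + Wop Φ W p x) * covD3 Φ T p i j k x

/-- `N_{piab} := Φ_{piab} − ½ Σ_{k,m} Φ^{km}(Φ_{mpi}Φ_{kab} + Φ_{mpa}Φ_{kib} + Φ_{mpb}Φ_{kia})`. -/
def Ncal {n : ℕ} (Φ : (Fin n → ℝ) → ℝ) (p i a b : Fin n) (x : Fin n → ℝ) : ℝ :=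
  pd4 Φ p i a b x - (1/2) * ∑ k, ∑ m, ihess Φ x k m *
    (pd3 Φ m p i x * pd3 Φ k a b x + pd3 Φ m p a x * pd3 Φ k i b x
      + pd3 Φ m p b x * pd3 Φ k i a x)

/-- Riemann curvature `R_{ikjl} := ¼ Σ_{a,m} Φ^{am}(Φ_{ila}Φ_{mkj} − Φ_{ija}Φ_{mkl})`. -/
def Rcal {n : ℕ} (Φ : (Fin n → ℝ) → ℝ) (i k j l : Fin n) (x : Fin n → ℝ) : ℝ :=
  (1/4) * ∑ a, ∑ m, ihess Φ x a m *
    (pd3 Φ i l a x * pd3 Φ m k j x - pd3 Φ i j a x * pd3 Φ m k l x)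

/-- The `h`-norm of a quadratic form `Q` at `x`:
`‖Q‖_h(x) = sup { Σ Q_{ij} v_i v_j : Σ Φ_{ij}(x) v_i v_j = 1 }`. -/
def hnorm {n : ℕ} (Φ : (Fin n → ℝ) → ℝ) (Q : Fin n → Fin n → ℝ) (x : Fin n → ℝ) : ℝ :=
  sSup {r | ∃ v : Fin n → ℝ,
    (∑ i, ∑ j, pd2 Φ i j x * v i * v j) = 1 ∧ r = ∑ i, ∑ j, Q i j * v i * v j}

/-- The matrix `A(x)` with entries `V_{ab} + Ŵ_{ab}`. -/
def Amat {n : ℕ} (Φ V W : (Fin n → ℝ) → ℝ) (x : Fin n → ℝ) : Matrix (Fin n) (Fin n) ℝ :=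
  Matrix.of fun a b => pd2 V a b x + What2 Φ W a b x

/-- The matrix `S_i(x)` with entries `V_{iab} − Ŵ_{iab}`. -/
def Smat {n : ℕ} (Φ V W : (Fin n → ℝ) → ℝ) (i : Fin n) (x : Fin n → ℝ) :
    Matrix (Fin n) (Fin n) ℝ :=
  Matrix.of fun a b => pd3 V i a b x - What3 Φ W i a b x

/-- `H_{ij}(x) := Tr[A(x)⁻¹ · S_i(x) · (D²Φ(x))⁻¹ · S_j(x)]`. -/
def Hten {n : ℕ} (Φ V W : (Fin n → ℝ) → ℝ) (i j : Fin n) (x : Fin n → ℝ) : ℝ :=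
  ((Amat Φ V W x)⁻¹ * Smat Φ V W i x * (hess Φ x)⁻¹ * Smat Φ V W j x).trace

/-- Euclidean operator norm of a matrix. -/
def eOpNorm {n : ℕ} (M : Matrix (Fin n) (Fin n) ℝ) : ℝ :=
  ‖LinearMap.toContinuousLinearMap (Matrix.toEuclideanLin M)‖

/-- Directional derivative of the Hessian: the matrix `∂_e D²F(x)`. -/
def dirHess {n : ℕ} (F : (Fin n → ℝ) → ℝ) (e : Fin n → ℝ) (x : Fin n → ℝ) :
    Matrix (Fin n) (Fin n) ℝ :=
  Matrix.of fun i j => ∑ k, e k * pd3 F k i j x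

/-- The quadratic form `⟨Qy, y⟩`. -/
def qform {n : ℕ} (Q : Matrix (Fin n) (Fin n) ℝ) (y : Fin n → ℝ) : ℝ :=
  ∑ i, ∑ j, Q i j * y j * y i

/-- The contraction `Σ_{p,q} B_{pq} f_{pq}` of a matrix-valued family against a scalar matrix. -/
def contr {n : ℕ} (B : Matrix (Fin n) (Fin n) ℝ)
    (f : Fin n → Fin n → Matrix (Fin n) (Fin n) ℝ) : Matrix (Fin n) (Fin n) ℝ :=
  ∑ p, ∑ q, B p q • f p q

/-- The linear combination `Σ_m u_m T_m` of a family of matrices. -/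
def lin {n : ℕ} (T : Fin n → Matrix (Fin n) (Fin n) ℝ) (u : Fin n → ℝ) :
    Matrix (Fin n) (Fin n) ℝ :=
  ∑ m, u m • T m

section algebra

variable {n : ℕ}

lemma contr_add (B : Matrix (Fin n) (Fin n) ℝ) (f g : Fin n → Fin n → Matrix (Fin n) (Fin n) ℝ) :
    contr B (fun p q => f p q + g p q) = contr B f + contr B g := by
  simp [contr, smul_add, Finset.sum_add_distrib]

lemma contr_sub (B : Matrix (Fin n) (Fin n) ℝ) (f g : Fin n → Fin n → Matrix (Fin n) (Fin n) ℝ) :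
    contr B (fun p q => f p q - g p q) = contr B f - contr B g := by
  simp [contr, smul_sub, Finset.sum_sub_distrib]

lemma contr_smul (B : Matrix (Fin n) (Fin n) ℝ) (r : ℝ)
    (f : Fin n → Fin n → Matrix (Fin n) (Fin n) ℝ) :
    contr B (fun p q => r • f p q) = r • contr B f := by
  simp [contr, Finset.smul_sum, smul_comm r]

lemma contr_mul_const (B M : Matrix (Fin n) (Fin n) ℝ)
    (f : Fin n → Fin n → Matrix (Fin n) (Fin n) ℝ) :
    contr B (fun p q => f p q * M) = contr B f * M := by
  simp [contr, Finset.sum_mul]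

lemma contr_const_mul (B M : Matrix (Fin n) (Fin n) ℝ)
    (f : Fin n → Fin n → Matrix (Fin n) (Fin n) ℝ) :
    contr B (fun p q => M * f p q) = M * contr B f := by
  simp [contr, Finset.mul_sum]

lemma contr_swap {B : Matrix (Fin n) (Fin n) ℝ} (hB : ∀ p q, B p q = B q p)
    (f : Fin n → Fin n → Matrix (Fin n) (Fin n) ℝ) :
    contr B (fun p q => f q p) = contr B f := by
  unfold contr
  rw [Finset.sum_comm]
  simp only [hB]

lemma lin_add (f g : Fin n → Matrix (Fin n) (Fin n) ℝ) (u : Fin n → ℝ) :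
    lin (fun m => f m + g m) u = lin f u + lin g u := by
  simp [lin, smul_add, Finset.sum_add_distrib]

lemma lin_sub (f g : Fin n → Matrix (Fin n) (Fin n) ℝ) (u : Fin n → ℝ) :
    lin (fun m => f m - g m) u = lin f u - lin g u := by
  simp [lin, smul_sub, Finset.sum_sub_distrib]

lemma lin_smul (r : ℝ) (f : Fin n → Matrix (Fin n) (Fin n) ℝ) (u : Fin n → ℝ) :
    lin (fun m => r • f m) u = r • lin f u := by
  simp [lin, Finset.smul_sum, smul_comm r]

lemma lin_mul_const (f : Fin n → Matrix (Fin n) (Fin n) ℝ) (M : Matrix (Fin n) (Fin n) ℝ)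
    (u : Fin n → ℝ) : lin (fun m => f m * M) u = lin f u * M := by
  simp [lin, Finset.sum_mul]

lemma lin_const_mul (f : Fin n → Matrix (Fin n) (Fin n) ℝ) (M : Matrix (Fin n) (Fin n) ℝ)
    (u : Fin n → ℝ) : lin (fun m => M * f m) u = M * lin f u := by
  simp [lin, Finset.mul_sum]

lemma lin_add_vec (f : Fin n → Matrix (Fin n) (Fin n) ℝ) (u w : Fin n → ℝ) :
    lin f (fun m => u m + w m) = lin f u + lin f w := by
  simp [lin, add_smul, Finset.sum_add_distrib]

lemma lin_sub_vec (f : Fin n → Matrix (Fin n) (Fin n) ℝ) (u w : Fin n → ℝ) :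
    lin f (fun m => u m - w m) = lin f u - lin f w := by
  simp [lin, sub_smul, Finset.sum_sub_distrib]

lemma lin_smul_vec (r : ℝ) (f : Fin n → Matrix (Fin n) (Fin n) ℝ) (u : Fin n → ℝ) :
    lin f (fun m => r * u m) = r • lin f u := by
  simp [lin, Finset.smul_sum, mul_smul]

lemma contr_lin (B : Matrix (Fin n) (Fin n) ℝ) (T : Fin n → Matrix (Fin n) (Fin n) ℝ)
    (u : Fin n → Fin n → Fin n → ℝ) :
    contr B (fun p q => lin T (u p q)) = lin T (fun m => ∑ p, ∑ q, B p q * u p q m) := by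
  simp only [contr, lin, Finset.sum_smul, Finset.smul_sum, mul_smul]
  conv_rhs => rw [Finset.sum_comm]
  refine Finset.sum_congr rfl fun p _ => ?_
  rw [Finset.sum_comm]

/-- Contracting a family of linear combinations of `T` whose coefficients are columns of
`M_{pq}`. -/
lemma contr_lin_col (B : Matrix (Fin n) (Fin n) ℝ) (T : Fin n → Matrix (Fin n) (Fin n) ℝ)
    (M : Fin n → Fin n → Matrix (Fin n) (Fin n) ℝ) (c : Fin n) :
    contr B (fun p q => lin T (fun m => M p q m c)) = lin T (fun m => contr B M m c) := by
  rw [contr_lin]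
  simp [contr, Matrix.sum_apply]

/-- The linear combination over `p` of linear combinations with coefficients in a column of
`M_p`. -/
lemma lin_lin_col (T M : Fin n → Matrix (Fin n) (Fin n) ℝ) (u : Fin n → ℝ) (c : Fin n) :
    lin (fun p => lin T (fun m => M p m c)) u = lin T (fun m => lin M u m c) := by
  simp only [lin, Matrix.sum_apply, Matrix.smul_apply, smul_eq_mul, Finset.sum_smul,
    Finset.smul_sum, mul_smul]
  rw [Finset.sum_comm]

variable {G : Matrix (Fin n) (Fin n) ℝ} {T : Fin n → Matrix (Fin n) (Fin n) ℝ}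

lemma mul_cubic_swap (h₁ : ∀ i a b, T i a b = T a i b) (h₂ : ∀ i a b, T i a b = T i b a)
    (p c m : Fin n) : (G * T p) m c = (G * T c) m p := by
  simp only [Matrix.mul_apply]
  refine Finset.sum_congr rfl fun k _ => ?_
  rw [h₂ p k c, h₁ p c k, h₂ c p k]

/-- Contraction of the first slot of a bilinear family through `G T_p`. -/
lemma contr_lin_first (hG : ∀ p q, G p q = G q p) (h₁ : ∀ i a b, T i a b = T a i b)
    (h₂ : ∀ i a b, T i a b = T i b a) (f : Fin n → Fin n → Matrix (Fin n) (Fin n) ℝ) (c : Fin n) :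
    contr G (fun q p => lin (f q) (fun m => (G * T p) m c)) = contr (G * T c * G) f := by
  simp only [mul_cubic_swap h₁ h₂ _ c]
  simp only [contr, lin, Finset.smul_sum, smul_smul]
  refine Finset.sum_congr rfl fun q _ => ?_
  rw [Finset.sum_comm]
  refine Finset.sum_congr rfl fun m _ => ?_
  rw [← Finset.sum_smul]
  congr 1
  have : G * T c * G = (G * T c * G).transpose := by
    have hG' : G.transpose = G := by ext a b; simp [hG a b]
    have hT' : (T c).transpose = T c := by ext a b; simp [h₂ c a b]
    simp [Matrix.transpose_mul, hG', hT', Matrix.mul_assoc]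
  rw [this, Matrix.transpose_apply, Matrix.mul_apply]
  refine Finset.sum_congr rfl fun p _ => ?_
  rw [hG q p, mul_comm]

lemma sandwich_symm (hG : ∀ p q, G p q = G q p) (h₂ : ∀ i a b, T i a b = T i b a) (c : Fin n)
    (p q : Fin n) : (G * T c * G) p q = (G * T c * G) q p := by
  have hG' : G.transpose = G := by ext a b; simp [hG a b]
  have hT' : (T c).transpose = T c := by ext a b; simp [h₂ c a b]
  have : (G * T c * G).transpose = G * T c * G := by
    simp [Matrix.transpose_mul, hG', hT', Matrix.mul_assoc]
  exact congrFun (congrFun this q) p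

/-- `Σ B_{pm} T_{pmk}` with `B = G T_c G` is the `(k,c)` entry of `Σ G_{pq} T_p G T_q`. -/
lemma sum_sandwich_mul_cubic (hG : ∀ p q, G p q = G q p) (h₁ : ∀ i a b, T i a b = T a i b)
    (h₂ : ∀ i a b, T i a b = T i b a) (c k : Fin n) :
    ∑ p, ∑ m, (G * T c * G) p m * T p k m = contr G (fun p q => T p * G * T q) k c := by
  have hM : ∀ p q, (T p * G * T q) k c = ∑ s, T p k s * (G * T c) s q := by
    intro p q
    rw [mul_assoc, Matrix.mul_apply]
    refine Finset.sum_congr rfl fun s _ => ?_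
    rw [mul_cubic_swap h₁ h₂]
  simp only [contr, Matrix.sum_apply, Matrix.smul_apply, smul_eq_mul, hM]
  refine Finset.sum_congr rfl fun p _ => ?_
  simp only [sandwich_symm hG h₂ c p, Matrix.mul_apply (M := G * T c), Finset.sum_mul,
    Finset.mul_sum]
  rw [Finset.sum_comm]
  refine Finset.sum_congr rfl fun q _ => Finset.sum_congr rfl fun s _ => ?_
  rw [hG q p]
  ring

variable (G T) in
/-- The covariant derivative `∇_p T_c` of the cubic form, as a matrix, where `F` collects the
partial derivatives of `T`. -/
def covCubic (F : Fin n → Fin n → Matrix (Fin n) (Fin n) ℝ) (p c : Fin n) :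
    Matrix (Fin n) (Fin n) ℝ :=
  F p c - (1/2 : ℝ) • (T p * G * T c + T c * G * T p)
    - (1/2 : ℝ) • lin T (fun m => (G * T p) m c)

variable (G T) in
/-- The partial derivative in direction `q` of `covCubic G T F p c`, where `P` collects the partial
derivatives of `F`. -/
def covCubicPd (F : Fin n → Fin n → Matrix (Fin n) (Fin n) ℝ)
    (P : Fin n → Fin n → Fin n → Matrix (Fin n) (Fin n) ℝ) (q p c : Fin n) :
    Matrix (Fin n) (Fin n) ℝ :=
  P q p c
    - (1/2 : ℝ) • (F q p * G * T c - T p * G * T q * G * T c + T p * G * F q c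
      + (F q c * G * T p - T c * G * T q * G * T p + T c * G * F q p))
    - (1/2 : ℝ) • (lin T (fun m => (G * F q p - G * T q * G * T p) m c)
      + lin (F q) (fun m => (G * T p) m c))

variable (G T) in
/-- The second covariant derivative `∇_q ∇_p T_c` of the cubic form, as a matrix. -/
def covCubic₂ (F : Fin n → Fin n → Matrix (Fin n) (Fin n) ℝ)
    (P : Fin n → Fin n → Fin n → Matrix (Fin n) (Fin n) ℝ) (q p c : Fin n) :
    Matrix (Fin n) (Fin n) ℝ :=
  covCubicPd G T F P q p c
    - (1/2 : ℝ) • (T q * G * covCubic G T F p c + covCubic G T F p c * G * T q)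
    - (1/2 : ℝ) • lin (fun m => covCubic G T F m c) (fun m => (G * T q) m p)
    - (1/2 : ℝ) • lin (fun m => covCubic G T F p m) (fun m => (G * T q) m c)

/-- The weighted Laplacian of the cubic form: the fourth and fifth order terms are eliminated by
the twice and three times differentiated transport equation. -/
lemma weighted_laplacian_cubic (hG : ∀ p q, G p q = G q p) (h₁ : ∀ i a b, T i a b = T a i b)
    (h₂ : ∀ i a b, T i a b = T i b a) {F : Fin n → Fin n → Matrix (Fin n) (Fin n) ℝ}
    {P : Fin n → Fin n → Fin n → Matrix (Fin n) (Fin n) ℝ}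
    {Wm D : Matrix (Fin n) (Fin n) ℝ} {S : Fin n → Matrix (Fin n) (Fin n) ℝ} {w : Fin n → ℝ}
    (hK : contr G F = lin T w + Wm - D + contr G (fun p q => T p * G * T q)) (c : Fin n)
    (hP : contr G (fun q p => P q p c) = contr (G * T c * G) F + lin (fun m => F m c) w
      + lin T (fun m => (G * Wm) m c) + T c * G * Wm + Wm * G * T c - S c
      - contr (G * T c * G) (fun p q => T p * G * T q)
      + contr G (fun p q => F p c * G * T q) + contr G (fun p q => T p * G * F q c)
      - contr G (fun p q => T p * G * T c * G * T q)) :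
    contr G (fun q p => covCubic₂ G T F P q p c)
      - lin (fun p => covCubic G T F p c)
          (fun m => w m - (1/2) * ∑ q, ∑ p, G q p * (G * T q) m p)
      = - S c + (1/2 : ℝ) • ((D + Wm) * G * T c + T c * G * (D + Wm))
        + (1/2 : ℝ) • lin T (fun m => (G * (D + Wm)) m c)
        + (1/4 : ℝ) • lin T (fun m => (G * contr G (fun p q => T p * G * T q)) m c)
        + (1/4 : ℝ) • (contr G (fun p q => T p * G * T q) * G * T c
          + T c * G * contr G (fun p q => T p * G * T q)
          - (2 : ℝ) • contr G (fun p q => T p * G * T c * G * T q)) := by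
  set gm := contr G (fun p q => T p * G * T q) with hgm
  have e0 : contr G (fun q p => lin T (fun m => (G * F q p - G * T q * G * T p) m c))
      = lin T (fun m => (G * contr G F) m c) - lin T (fun m => (G * gm) m c) := by
    have : contr G (fun q p => G * T q * G * T p) = G * gm := by
      rw [hgm, ← contr_const_mul]
      simp only [mul_assoc]
    rw [contr_lin_col, contr_sub, contr_const_mul, this, ← lin_sub_vec]
    simp only [Matrix.sub_apply]
  have e1 : contr G (fun q p => lin (F q) (fun m => (G * T p) m c)) = contr (G * T c * G) F :=
    contr_lin_first hG h₁ h₂ F c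
  have e2 : contr G (fun q p => lin (fun m => covCubic G T F p m) (fun m => (G * T q) m c))
      = contr (G * T c * G) F - contr (G * T c * G) (fun p q => T p * G * T q)
        - (1/2 : ℝ) • lin T (fun m => (G * gm) m c) := by
    rw [contr_swap hG (fun p q => lin (fun m => covCubic G T F p m) (fun m => (G * T q) m c)),
      contr_lin_first hG h₁ h₂]
    simp only [covCubic, contr_sub, contr_smul, contr_add]
    have := contr_swap (sandwich_symm hG h₂ c) (fun p q => T p * G * T q)
    rw [this, contr_lin]
    have : ∀ m, ∑ p, ∑ q, (G * T c * G) p q * (G * T p) m q = (G * gm) m c := by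
      intro m
      rw [Matrix.mul_apply]
      simp only [hgm, ← sum_sandwich_mul_cubic hG h₁ h₂, Matrix.mul_apply (M := G) (N := T _)]
      simp only [Finset.mul_sum]
      conv_rhs => rw [Finset.sum_comm]
      refine Finset.sum_congr rfl fun p _ => ?_
      rw [Finset.sum_comm]
      refine Finset.sum_congr rfl fun q _ => Finset.sum_congr rfl fun r _ => ?_
      ring
    simp only [this]
    module
  have e3 : contr G (fun q p => T q * G * lin T (fun m => (G * T p) m c))
      = contr (G * T c * G) (fun p q => T p * G * T q) := by
    rw [← contr_lin_first hG h₁ h₂]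
    simp only [lin_const_mul]
  have e4 : contr G (fun q p => lin T (fun m => (G * T p) m c) * G * T q)
      = contr (G * T c * G) (fun p q => T p * G * T q) := by
    rw [← contr_swap (sandwich_symm hG h₂ c), ← contr_lin_first hG h₁ h₂]
    simp only [lin_mul_const]
  have s1 : contr G (fun q p => T p * G * F q c) = contr G (fun p q => T p * G * F q c) :=
    contr_swap hG (fun p q => T p * G * F q c)
  have s2 : contr G (fun q p => F p c * G * T q) = contr G (fun p q => F p c * G * T q) :=
    contr_swap hG (fun p q => F p c * G * T q)
  have s3 : contr G (fun q p => T p * G * T q) = gm :=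
    contr_swap hG (fun p q => T p * G * T q)
  have s4 : contr G (fun q p => T p * G * T c * G * T q)
      = contr G (fun p q => T p * G * T c * G * T q) :=
    contr_swap hG (fun p q => T p * G * T c * G * T q)
  have s5 : contr G (fun q p => T c * G * T q * G * T p) = T c * G * gm := by
    rw [hgm, ← contr_const_mul]
    simp only [mul_assoc]
  have s6 : contr G (fun q p => T c * G * T p * G * T q) = T c * G * gm := by
    rw [← s3, ← contr_const_mul]
    simp only [mul_assoc]
  have s7 : contr G (fun q p => T p * G * T q * G * T c) = gm * G * T c := by
    rw [contr_mul_const, contr_mul_const, s3]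
  have s8 : contr G (fun q p => T q * G * T p * G * T c) = gm * G * T c := by
    rw [contr_mul_const, contr_mul_const]
  have s9 : contr G (fun q p => F q p * G * T c) = contr G F * G * T c := by
    rw [contr_mul_const, contr_mul_const]
  have s10 : contr G (fun q p => T c * G * F q p) = T c * G * contr G F := by
    rw [contr_const_mul]
  have c1 : contr G (fun q p => covCubicPd G T F P q p c) = contr G (fun q p => P q p c)
      - (1/2 : ℝ) • (contr G F * G * T c - gm * G * T c + contr G (fun p q => T p * G * F q c)
        + (contr G (fun p q => F p c * G * T q) - T c * G * gm + T c * G * contr G F))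
      - (1/2 : ℝ) • (lin T (fun m => (G * contr G F) m c) - lin T (fun m => (G * gm) m c)
        + contr (G * T c * G) F) := by
    simp only [covCubicPd, contr_sub, contr_smul, contr_add, e0, e1, s1, s5, s7, s9, s10]
  have c2 : contr G (fun q p => T q * G * covCubic G T F p c)
      = contr G (fun p q => T p * G * F q c)
        - (1/2 : ℝ) • (gm * G * T c + contr G (fun p q => T p * G * T c * G * T q))
        - (1/2 : ℝ) • contr (G * T c * G) (fun p q => T p * G * T q) := by
    simp only [covCubic, mul_sub, mul_add, mul_smul_comm, ← mul_assoc]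
    simp only [contr_sub, contr_smul, contr_add, e3, s8]
  have c3 : contr G (fun q p => covCubic G T F p c * G * T q)
      = contr G (fun p q => F p c * G * T q)
        - (1/2 : ℝ) • (contr G (fun p q => T p * G * T c * G * T q) + T c * G * gm)
        - (1/2 : ℝ) • contr (G * T c * G) (fun p q => T p * G * T q) := by
    simp only [covCubic, sub_mul, add_mul, smul_mul_assoc]
    simp only [contr_sub, contr_smul, contr_add, e4, s2, s4, s6]
  have c4 : lin (fun p => covCubic G T F p c) w = lin (fun p => F p c) w
      - (1/2 : ℝ) • (lin T w * G * T c + T c * G * lin T w)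
      - (1/2 : ℝ) • lin T (fun m => (G * lin T w) m c) := by
    simp only [covCubic, lin_sub, lin_smul, lin_add, lin_mul_const, lin_const_mul, lin_lin_col]
  rw [lin_sub_vec, lin_smul_vec, c4]
  simp only [covCubic₂]
  rw [contr_sub, contr_sub, contr_sub, c1, contr_smul, contr_smul, contr_smul, contr_add, c2, c3,
    contr_lin, e2, hP, hK]
  have v1 : lin T (fun m => (G * (lin T w + Wm - D + gm)) m c)
      = lin T (fun m => (G * lin T w) m c) + lin T (fun m => (G * Wm) m c)
        - lin T (fun m => (G * D) m c) + lin T (fun m => (G * gm) m c) := by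
    simp only [← lin_add_vec, ← lin_sub_vec, mul_add, mul_sub, Matrix.add_apply, Matrix.sub_apply]
  have v2 : lin T (fun m => (G * (D + Wm)) m c)
      = lin T (fun m => (G * D) m c) + lin T (fun m => (G * Wm) m c) := by
    simp only [← lin_add_vec, mul_add, Matrix.add_apply]
  rw [v1, v2]
  simp only [add_mul, sub_mul, mul_add, mul_sub]
  module

end algebra

section positivity

variable {n : ℕ} {G A : Matrix (Fin n) (Fin n) ℝ} {T : Fin n → Matrix (Fin n) (Fin n) ℝ}

lemma trace_cubic (hG : ∀ p q, G p q = G q p) (h₁ : ∀ i a b, T i a b = T a i b)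
    (h₂ : ∀ i a b, T i a b = T i b a) (i j : Fin n) :
    (G * T i * G * T j).trace = contr G (fun p q => T p * G * T q) i j := by
  rw [← sum_sandwich_mul_cubic hG h₁ h₂, mul_assoc, Matrix.trace_mul_comm, ← mul_assoc,
    Matrix.trace]
  refine Finset.sum_congr rfl fun p _ => ?_
  rw [Matrix.diag_apply, Matrix.mul_apply]
  refine Finset.sum_congr rfl fun m _ => ?_
  rw [h₂ i m p, h₁ i p m]

open scoped MatrixOrder in
lemma trace_mul_sandwich_nonneg (hA : A.PosSemidef) (hG : G.PosSemidef)
    (Y : Matrix (Fin n) (Fin n) ℝ) : 0 ≤ (A * Y * G * Y.transpose).trace := by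
  obtain ⟨R, rfl⟩ := CStarAlgebra.nonneg_iff_eq_star_mul_self.mp hA.nonneg
  have := (hG.mul_mul_conjTranspose_same (R * Y)).trace_nonneg
  rw [Matrix.conjTranspose_mul, ← mul_assoc, Matrix.trace_mul_comm] at this
  simpa [mul_assoc, Matrix.star_eq_conjTranspose] using this

open scoped MatrixOrder in
lemma sum_mul_trace_sandwich_nonneg (hG : G.PosSemidef)
    (M : Fin n → Matrix (Fin n) (Fin n) ℝ) :
    0 ≤ ∑ p, ∑ q, G p q * (G * M p * G * (M q).transpose).trace := by
  obtain ⟨R, hR⟩ := CStarAlgebra.nonneg_iff_eq_star_mul_self.mp hG.nonneg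
  have key : ∑ p, ∑ q, G p q * (G * M p * G * (M q).transpose).trace
      = ∑ e, (G * lin M (R e) * G * (lin M (R e)).transpose).trace := by
    have : ∀ p q, G p q = ∑ e, R e p * R e q := by
      intro p q
      rw [hR, Matrix.mul_apply]
      simp
    simp only [lin, Matrix.transpose_sum, Matrix.transpose_smul, Finset.mul_sum, Finset.sum_mul,
      Matrix.trace_sum, mul_smul_comm, smul_mul_assoc, Matrix.trace_smul, smul_eq_mul]
    simp_rw [this, Finset.sum_mul]
    conv_rhs => rw [Finset.sum_comm]
    conv_lhs => rw [Finset.sum_comm]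
    refine Finset.sum_congr rfl fun q _ => ?_
    rw [Finset.sum_comm]
    refine Finset.sum_congr rfl fun e _ => Finset.sum_congr rfl fun p _ => ?_
    ring
  rw [key]
  exact Finset.sum_nonneg fun e _ => trace_mul_sandwich_nonneg hG hG _

lemma sum_comm₄ (f : Fin n → Fin n → Fin n → Fin n → ℝ) :
    ∑ p, ∑ q, ∑ i, ∑ j, f p q i j = ∑ i, ∑ j, ∑ p, ∑ q, f p q i j := by
  have h : ∀ p, ∑ q, ∑ i, ∑ j, f p q i j = ∑ i, ∑ j, ∑ q, f p q i j := fun p => by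
    rw [Finset.sum_comm]
    exact Finset.sum_congr rfl fun i _ => Finset.sum_comm
  simp only [h]
  rw [Finset.sum_comm]
  exact Finset.sum_congr rfl fun i _ => Finset.sum_comm

lemma trace_mul_contr_mul (B C : Matrix (Fin n) (Fin n) ℝ)
    (f : Fin n → Fin n → Matrix (Fin n) (Fin n) ℝ) :
    (B * contr G f * C).trace = ∑ p, ∑ q, G p q * (B * f p q * C).trace := by
  simp only [contr, Finset.mul_sum, Finset.sum_mul, Matrix.trace_sum, mul_smul_comm,
    smul_mul_assoc, Matrix.trace_smul, smul_eq_mul]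

lemma sum_trace_mul_lin (B C : Matrix (Fin n) (Fin n) ℝ) (M M' : Fin n → Matrix (Fin n) (Fin n) ℝ)
    (v : Fin n → ℝ) :
    ∑ i, ∑ j, (B * M i * C * M' j).trace * v i * v j = (B * lin M v * C * lin M' v).trace := by
  simp only [lin, Finset.mul_sum, Finset.sum_mul, Matrix.trace_sum, mul_smul_comm, smul_mul_assoc,
    Matrix.trace_smul, smul_eq_mul]
  rw [Finset.sum_comm]
  refine Finset.sum_congr rfl fun e _ => Finset.sum_congr rfl fun p _ => ?_
  ring

lemma lin_lin (T : Fin n → Matrix (Fin n) (Fin n) ℝ) (K : Matrix (Fin n) (Fin n) ℝ)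
    (v : Fin n → ℝ) :
    lin (fun c => lin T (fun m => K m c)) v = lin T (fun m => ∑ c, K m c * v c) := by
  simp only [lin, Finset.sum_smul, Finset.smul_sum, smul_smul]
  rw [Finset.sum_comm]
  refine Finset.sum_congr rfl fun e _ => Finset.sum_congr rfl fun p _ => ?_
  rw [mul_comm]

lemma trace_lin_mulVec (hG : ∀ p q, G p q = G q p) (h₁ : ∀ i a b, T i a b = T a i b)
    (h₂ : ∀ i a b, T i a b = T i b a) (K : Matrix (Fin n) (Fin n) ℝ) (v : Fin n → ℝ) :
    (G * lin T (fun m => ∑ c, K m c * v c) * G * lin T v).trace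
      = ∑ i, ∑ j, (K.transpose * contr G (fun p q => T p * G * T q)) i j * v i * v j := by
  have : (G * lin T (fun m => ∑ c, K m c * v c) * G * lin T v).trace
      = ∑ i, ∑ m, ∑ j, (K m i * v i) * (v j * (G * T m * G * T j).trace) := by
    simp only [lin, Finset.mul_sum, Finset.sum_mul, Matrix.trace_sum, mul_smul_comm,
      smul_mul_assoc, Matrix.trace_smul, smul_eq_mul]
    rw [Finset.sum_comm]
    conv_rhs => rw [Finset.sum_comm]
    refine Finset.sum_congr rfl fun m _ => ?_
    rw [Finset.sum_comm]
    refine Finset.sum_congr rfl fun c _ => Finset.sum_congr rfl fun j _ => ?_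
    ring
  rw [this]
  refine Finset.sum_congr rfl fun i _ => ?_
  rw [Finset.sum_comm]
  refine Finset.sum_congr rfl fun j _ => ?_
  rw [Matrix.mul_apply, Finset.sum_mul, Finset.sum_mul]
  refine Finset.sum_congr rfl fun m _ => ?_
  rw [trace_cubic hG h₁ h₂, Matrix.transpose_apply]
  ring

/-- The sum of a completed square, the norm of the covariant derivative of the cubic form and the
norm of its commutators. -/
lemma quadratic_form_nonneg (hG : G.PosDef) (hA : A.PosDef) (h₁ : ∀ i a b, T i a b = T a i b)
    (h₂ : ∀ i a b, T i a b = T i b a) {S J : Fin n → Matrix (Fin n) (Fin n) ℝ}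
    (hS : ∀ i, (S i).transpose = S i) {N : Fin n → Fin n → Matrix (Fin n) (Fin n) ℝ}
    (hN : ∀ p i, (N p i).transpose = N p i)
    (hJ : ∀ c, J c = - S c + (1/2 : ℝ) • (A * G * T c + T c * G * A)
        + (1/2 : ℝ) • lin T (fun m => (G * A) m c)
        + (1/4 : ℝ) • lin T (fun m => (G * contr G (fun p q => T p * G * T q)) m c)
        + (1/4 : ℝ) • (contr G (fun p q => T p * G * T q) * G * T c
          + T c * G * contr G (fun p q => T p * G * T q)
          - (2 : ℝ) • contr G (fun p q => T p * G * T c * G * T q))) (v : Fin n → ℝ) :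
    0 ≤ ∑ i, ∑ j, ((A⁻¹ * S i * G * S j).trace
      + 2 * ((G * J i * G * T j).trace + (G * T i * G * J j).trace
        + 2 * ∑ p, ∑ q, G p q * (G * N p i * G * N q j).trace)
      - (A * G * contr G (fun p q => T p * G * T q)) i j
      - (A * G * contr G (fun p q => T p * G * T q)) j i
      - (contr G (fun p q => T p * G * T q) * G * contr G (fun p q => T p * G * T q)) i j)
      * v i * v j := by
  have hGs : G.transpose = G := by simpa using hG.isHermitian.eq
  have hG' : ∀ p q, G p q = G q p := fun p q => congrFun (congrFun hGs q) p
  have hAs : A.transpose = A := by simpa using hA.isHermitian.eq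
  have hTs : ∀ i, (T i).transpose = T i := fun i => by ext a b; exact h₂ i b a
  have hlin : ∀ (M : Fin n → Matrix (Fin n) (Fin n) ℝ) (u : Fin n → ℝ),
      (∀ i, (M i).transpose = M i) → (lin M u).transpose = lin M u := by
    intro M u hM
    simp [lin, Matrix.transpose_sum, hM]
  set gm := contr G (fun p q => T p * G * T q) with hgm
  have hgs : gm.transpose = gm := by
    ext i j
    rw [Matrix.transpose_apply, hgm, ← trace_cubic hG' h₁ h₂, ← trace_cubic hG' h₁ h₂, mul_assoc,
      Matrix.trace_mul_comm]
    simp only [mul_assoc]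
  set X := lin T v with hX
  set Sv := lin S v with hSv
  have hXs : X.transpose = X := hlin T v hTs
  have hSs : Sv.transpose = Sv := hlin S v hS
  have hJv : lin J v = - Sv + (1/2 : ℝ) • (A * G * X + X * G * A)
      + (1/2 : ℝ) • lin T (fun m => ∑ c, (G * A) m c * v c)
      + (1/4 : ℝ) • lin T (fun m => ∑ c, (G * gm) m c * v c)
      + (1/4 : ℝ) • (gm * G * X + X * G * gm
          - (2 : ℝ) • contr G (fun p q => T p * G * X * G * T q)) := by
    have e : lin (fun c => contr G (fun p q => T p * G * T c * G * T q)) v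
        = contr G (fun p q => T p * G * X * G * T q) := by
      simp only [contr, lin, hX, Finset.smul_sum, Finset.mul_sum, Finset.sum_mul, mul_smul_comm,
        smul_mul_assoc, smul_smul]
      rw [Finset.sum_comm]
      refine Finset.sum_congr rfl fun p _ => ?_
      rw [Finset.sum_comm]
      refine Finset.sum_congr rfl fun q _ => Finset.sum_congr rfl fun c _ => ?_
      rw [mul_comm]
    have : lin (fun c => - S c) v = - Sv := by simp [lin, hSv]
    rw [funext hJ]
    simp only [lin_add, lin_sub, lin_smul, lin_mul_const, lin_const_mul, this, e, ← hX]
    rw [lin_lin, lin_lin]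
  have sq := trace_mul_sandwich_nonneg hA.inv.posSemidef hG.posSemidef
    (Sv - (2 : ℝ) • (A * G * X))
  have nrm := sum_mul_trace_sandwich_nonneg hG.posSemidef (fun p => lin (N p) v)
  have comm := sum_mul_trace_sandwich_nonneg hG.posSemidef (fun p => T p * G * X - X * G * T p)
  have hlinN : ∀ p, (lin (N p) v).transpose = lin (N p) v := fun p => hlin _ v (hN p)
  simp only [hlinN] at nrm
  have hquad : ∀ K : Matrix (Fin n) (Fin n) ℝ,
      ∑ i, ∑ j, K j i * v i * v j = ∑ i, ∑ j, K i j * v i * v j := by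
    intro K
    rw [Finset.sum_comm]
    refine Finset.sum_congr rfl fun i _ => Finset.sum_congr rfl fun j _ => ?_
    ring
  have split : ∑ i, ∑ j, ((A⁻¹ * S i * G * S j).trace
      + 2 * ((G * J i * G * T j).trace + (G * T i * G * J j).trace
        + 2 * ∑ p, ∑ q, G p q * (G * N p i * G * N q j).trace)
      - (A * G * gm) i j - (A * G * gm) j i - (gm * G * gm) i j) * v i * v j
      = (A⁻¹ * Sv * G * Sv).trace + 2 * ((G * lin J v * G * X).trace + (G * X * G * lin J v).trace
        + 2 * ∑ p, ∑ q, G p q * (G * lin (N p) v * G * lin (N q) v).trace)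
        - 2 * ∑ i, ∑ j, (A * G * gm) i j * v i * v j
        - ∑ i, ∑ j, (gm * G * gm) i j * v i * v j := by
    have hNN : ∑ p, ∑ q, G p q * (G * lin (N p) v * G * lin (N q) v).trace
        = ∑ i, ∑ j, (∑ p, ∑ q, G p q * (G * N p i * G * N q j).trace) * v i * v j := by
      simp only [← sum_trace_mul_lin, Finset.mul_sum, Finset.sum_mul]
      rw [sum_comm₄]
      simp only [mul_assoc]
    rw [hNN]
    obtain ⟨Q, hQ⟩ : ∃ Q : Fin n → Fin n → ℝ,
        ∀ i j, ∑ p, ∑ q, G p q * (G * N p i * G * N q j).trace = Q i j := ⟨_, fun _ _ => rfl⟩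
    simp only [hQ]
    have h6 := hquad (A * G * gm)
    simp only [hX, hSv, ← sum_trace_mul_lin]
    rw [two_mul (∑ i, ∑ j, (A * G * gm) i j * v i * v j)]
    nth_rewrite 1 [← h6]
    simp only [Finset.mul_sum, ← Finset.sum_add_distrib, ← Finset.sum_sub_distrib]
    refine Finset.sum_congr rfl fun i _ => Finset.sum_congr rfl fun j _ => ?_
    ring
  rw [split]
  have hcyc : (G * X * G * lin J v).trace = (G * lin J v * G * X).trace := by
    rw [mul_assoc, Matrix.trace_mul_comm, ← mul_assoc]
  have q5 : (G * lin T (fun m => ∑ c, (G * A) m c * v c) * G * X).trace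
      = ∑ i, ∑ j, (A * G * gm) i j * v i * v j := by
    rw [hX, trace_lin_mulVec hG' h₁ h₂, Matrix.transpose_mul, hGs, hAs]
  have q7 : (G * lin T (fun m => ∑ c, (G * gm) m c * v c) * G * X).trace
      = ∑ i, ∑ j, (gm * G * gm) i j * v i * v j := by
    rw [hX, trace_lin_mulVec hG' h₁ h₂, Matrix.transpose_mul, hGs, hgs]
  have hsq : (A⁻¹ * (Sv - (2 : ℝ) • (A * G * X)) * G
      * (Sv - (2 : ℝ) • (A * G * X)).transpose).trace
      = (A⁻¹ * Sv * G * Sv).trace - 4 * (G * Sv * G * X).trace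
        + 4 * (G * X * G * X * G * A).trace := by
    have hu : IsUnit A.det := (Matrix.isUnit_iff_isUnit_det A).mp hA.isUnit
    have a1 : A⁻¹ * (A * G * X) * G * Sv = G * X * G * Sv := by
      simp only [mul_assoc]
      rw [← mul_assoc A⁻¹ A, Matrix.nonsing_inv_mul A hu, one_mul]
    have a2 : (A⁻¹ * Sv * G * (X * G * A)).trace = (G * Sv * G * X).trace := by
      have e1 := Matrix.trace_mul_comm (A⁻¹ * Sv * G * X * G) A
      have e2 := Matrix.trace_mul_comm (Sv * G * X) G
      simp only [← mul_assoc, Matrix.mul_nonsing_inv A hu, one_mul] at e1 e2 ⊢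
      rw [e1, e2]
    have a3 : (A⁻¹ * (A * G * X) * G * (X * G * A)) = G * X * G * X * G * A := by
      simp only [mul_assoc]
      rw [← mul_assoc A⁻¹ A, Matrix.nonsing_inv_mul A hu, one_mul]
    have a4 : (G * X * G * Sv).trace = (G * Sv * G * X).trace := by
      rw [mul_assoc, Matrix.trace_mul_comm, ← mul_assoc]
    have ht : (Sv - (2 : ℝ) • (A * G * X)).transpose = Sv - (2 : ℝ) • (X * G * A) := by
      simp [Matrix.transpose_mul, hSs, hXs, hGs, hAs, mul_assoc]
    rw [ht]
    simp only [mul_sub, sub_mul, mul_smul_comm, smul_mul_assoc, Matrix.trace_sub,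
      Matrix.trace_smul, smul_eq_mul, a1, a2, a3, a4]
    ring
  have hcomm : ∑ p, ∑ q, G p q * (G * (T p * G * X - X * G * T p) * G
      * (T q * G * X - X * G * T q).transpose).trace
      = 2 * (G * gm * G * X * G * X).trace
        - 2 * (G * contr G (fun p q => T p * G * X * G * T q) * G * X).trace := by
    have hpq : ∀ p q, (G * (T p * G * X - X * G * T p) * G
        * (T q * G * X - X * G * T q).transpose).trace
        = (G * (T q * G * T p) * (G * X * G * X)).trace
          + (G * (T p * G * T q) * (G * X * G * X)).trace
          - 2 * (G * (T p * G * X * G * T q) * (G * X)).trace := by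
      intro p q
      have ht : (T q * G * X - X * G * T q).transpose = X * G * T q - T q * G * X := by
        simp [Matrix.transpose_mul, hXs, hGs, hTs, mul_assoc]
      have t1 := Matrix.trace_mul_comm (G * T p * G * X * G * X) (G * T q)
      have t3 := Matrix.trace_mul_comm (G * X) (G * T p * G * X * G * T q)
      have t4 := Matrix.trace_mul_comm (G * X) (G * T p * G * T q * G * X)
      rw [ht]
      simp only [mul_sub, sub_mul, Matrix.trace_sub, ← mul_assoc] at t1 t3 t4 ⊢
      rw [t1, t3, t4]
      ring
    have hswap : contr G (fun p q => T q * G * T p) = gm :=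
      contr_swap hG' (fun p q => T p * G * T q)
    have r1 := trace_mul_contr_mul (G := G) G (G * X * G * X) (fun p q => T p * G * T q)
    have r2 := trace_mul_contr_mul (G := G) G (G * X * G * X) (fun p q => T q * G * T p)
    have r3 := trace_mul_contr_mul (G := G) G (G * X) (fun p q => T p * G * X * G * T q)
    rw [hswap] at r2
    rw [← hgm] at r1
    simp only [hpq]
    simp only [mul_sub, mul_add, Finset.sum_sub_distrib, Finset.sum_add_distrib, ← r1, ← r2,
      mul_left_comm _ (2 : ℝ), ← Finset.mul_sum, ← r3]
    simp only [← mul_assoc]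
    ring
  have hA1 : (G * (A * G * X) * G * X).trace = (G * X * G * X * G * A).trace := by
    simpa only [mul_assoc] using Matrix.trace_mul_comm (G * A) (G * X * G * X)
  have hA2 : (G * (X * G * A) * G * X).trace = (G * X * G * X * G * A).trace := by
    simpa only [mul_assoc] using Matrix.trace_mul_comm (G * X * G * A) (G * X)
  have hg2 : (G * (X * G * gm) * G * X).trace = (G * gm * G * X * G * X).trace := by
    simpa only [mul_assoc] using Matrix.trace_mul_comm (G * X) (G * gm * G * X)
  have hg1 : (G * (gm * G * X) * G * X).trace = (G * gm * G * X * G * X).trace := by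
    simp only [mul_assoc]
  rw [hsq] at sq
  rw [hcomm] at comm
  rw [hcyc, hJv]
  simp only [mul_add, mul_sub, add_mul, sub_mul, mul_smul_comm, smul_mul_assoc, Matrix.trace_add,
    Matrix.trace_sub, Matrix.trace_smul, smul_eq_mul, mul_neg, neg_mul, Matrix.trace_neg, q5, q7,
    hA1, hA2, hg1, hg2]
  linarith

end positivity

section partialDerivatives

variable {n : ℕ} {Ω : Set (Fin n → ℝ)} {f : (Fin n → ℝ) → ℝ} {x : Fin n → ℝ}

lemma pd_congr (hΩ : IsOpen Ω) {g : (Fin n → ℝ) → ℝ} (h : ∀ y ∈ Ω, f y = g y) (hx : x ∈ Ω)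
    (i : Fin n) : pd f i x = pd g i x := by
  have : f =ᶠ[nhds x] g := by filter_upwards [hΩ.mem_nhds hx] with y hy using h y hy
  rw [pd, pd, this.fderiv_eq]

lemma contDiffOn_pd (hΩ : IsOpen Ω) {k m : WithTop ℕ∞} (hf : ContDiffOn ℝ k f Ω) (hm : m + 1 ≤ k)
    (i : Fin n) : ContDiffOn ℝ m (pd f i) Ω :=
  (hf.fderiv_of_isOpen hΩ hm).clm_apply contDiffOn_const

lemma pd2_swap (hΩ : IsOpen Ω) (hf : ContDiffOn ℝ 2 f Ω) (hx : x ∈ Ω) (i j : Fin n) :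
    pd2 f i j x = pd2 f j i x := by
  have hc : ContDiffAt ℝ 2 f x := hf.contDiffAt (hΩ.mem_nhds hx)
  have hd : DifferentiableAt ℝ (fderiv ℝ f) x :=
    (hc.fderiv_right (m := 1) (by norm_num)).differentiableAt one_ne_zero
  have key : ∀ a b, pd2 f a b x = fderiv ℝ (fderiv ℝ f) x (Pi.single b 1) (Pi.single a 1) := by
    intro a b
    have : HasFDerivAt (pd f a)
        ((ContinuousLinearMap.apply ℝ ℝ (Pi.single a (1 : ℝ) : Fin n → ℝ)).comp
          (fderiv ℝ (fderiv ℝ f) x)) x :=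
      (ContinuousLinearMap.hasFDerivAt
        (ContinuousLinearMap.apply ℝ ℝ (Pi.single a (1 : ℝ) : Fin n → ℝ))).comp x hd.hasFDerivAt
    rw [pd2, pd, this.fderiv]
    rfl
  rw [key, key]
  exact (hc.isSymmSndFDerivAt (by simp)).eq _ _

lemma pd3_swap₁₂ (hΩ : IsOpen Ω) (hf : ContDiffOn ℝ 2 f Ω) (hx : x ∈ Ω) (i j k : Fin n) :
    pd3 f i j k x = pd3 f j i k x :=
  pd_congr hΩ (fun _ hy => pd2_swap hΩ hf hy i j) hx k

lemma pd3_swap₂₃ (hΩ : IsOpen Ω) (hf : ContDiffOn ℝ 3 f Ω) (hx : x ∈ Ω) (i j k : Fin n) :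
    pd3 f i j k x = pd3 f i k j x :=
  pd2_swap hΩ (contDiffOn_pd hΩ hf (by norm_num) i) hx j k

lemma pd4_swap₁₂ (hΩ : IsOpen Ω) (hf : ContDiffOn ℝ 2 f Ω) (hx : x ∈ Ω) (i j k l : Fin n) :
    pd4 f i j k l x = pd4 f j i k l x :=
  pd_congr hΩ (fun _ hy => pd3_swap₁₂ hΩ hf hy i j k) hx l

lemma pd4_swap₂₃ (hΩ : IsOpen Ω) (hf : ContDiffOn ℝ 3 f Ω) (hx : x ∈ Ω) (i j k l : Fin n) :
    pd4 f i j k l x = pd4 f i k j l x :=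
  pd3_swap₁₂ hΩ (contDiffOn_pd hΩ hf (by norm_num) i) hx j k l

lemma pd4_swap₃₄ (hΩ : IsOpen Ω) (hf : ContDiffOn ℝ 4 f Ω) (hx : x ∈ Ω) (i j k l : Fin n) :
    pd4 f i j k l x = pd4 f i j l k x :=
  pd3_swap₂₃ hΩ (contDiffOn_pd hΩ hf (by norm_num) i) hx j k l

lemma pd5_swap₁₂ (hΩ : IsOpen Ω) (hf : ContDiffOn ℝ 2 f Ω) (hx : x ∈ Ω) (i j k l m : Fin n) :
    pd5 f i j k l m x = pd5 f j i k l m x :=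
  pd_congr hΩ (fun _ hy => pd4_swap₁₂ hΩ hf hy i j k l) hx m

lemma pd5_swap₂₃ (hΩ : IsOpen Ω) (hf : ContDiffOn ℝ 3 f Ω) (hx : x ∈ Ω) (i j k l m : Fin n) :
    pd5 f i j k l m x = pd5 f i k j l m x :=
  pd4_swap₁₂ hΩ (contDiffOn_pd hΩ hf (by norm_num) i) hx j k l m

lemma pd5_swap₃₄ (hΩ : IsOpen Ω) (hf : ContDiffOn ℝ 4 f Ω) (hx : x ∈ Ω) (i j k l m : Fin n) :
    pd5 f i j k l m x = pd5 f i j l k m x :=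
  pd4_swap₂₃ hΩ (contDiffOn_pd hΩ hf (by norm_num) i) hx j k l m

lemma pd5_swap₄₅ (hΩ : IsOpen Ω) (hf : ContDiffOn ℝ 5 f Ω) (hx : x ∈ Ω) (i j k l m : Fin n) :
    pd5 f i j k l m x = pd5 f i j k m l x :=
  pd4_swap₃₄ hΩ (contDiffOn_pd hΩ hf (by norm_num) i) hx j k l m

end partialDerivatives

/-- `f` is differentiable at `x` and its partial derivative in direction `i` is `f'`. -/
def HasPd {n : ℕ} (f : (Fin n → ℝ) → ℝ) (f' : ℝ) (i : Fin n) (x : Fin n → ℝ) : Prop :=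
  DifferentiableAt ℝ f x ∧ pd f i x = f'

/-- Entrywise version of `HasPd` for matrix-valued functions. -/
def MatrixHasPd {n : ℕ} (M : (Fin n → ℝ) → Matrix (Fin n) (Fin n) ℝ)
    (M' : Matrix (Fin n) (Fin n) ℝ) (i : Fin n) (x : Fin n → ℝ) : Prop :=
  ∀ a b, HasPd (fun y => M y a b) (M' a b) i x

section differentiationRules

variable {n : ℕ} {i : Fin n} {x : Fin n → ℝ}

lemma HasPd.unique {f : (Fin n → ℝ) → ℝ} {f' g' : ℝ} (hf : HasPd f f' i x) (hg : HasPd f g' i x) :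
    f' = g' := hf.2.symm.trans hg.2

lemma HasPd.congr {f g : (Fin n → ℝ) → ℝ} {f' : ℝ} {Ω : Set (Fin n → ℝ)} (hf : HasPd f f' i x)
    (hΩ : IsOpen Ω) (hx : x ∈ Ω) (h : ∀ y ∈ Ω, f y = g y) : HasPd g f' i x := by
  refine ⟨hf.1.congr_of_eventuallyEq ?_, (pd_congr hΩ h hx i).symm.trans hf.2⟩
  filter_upwards [hΩ.mem_nhds hx] with y hy using (h y hy).symm

lemma hasPd_of_contDiffOn {f : (Fin n → ℝ) → ℝ} {Ω : Set (Fin n → ℝ)} (hΩ : IsOpen Ω)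
    (hx : x ∈ Ω) (hf : ContDiffOn ℝ 1 f Ω) : HasPd f (pd f i x) i x :=
  ⟨(hf.contDiffAt (hΩ.mem_nhds hx)).differentiableAt one_ne_zero, rfl⟩

lemma hasPd_const (c : ℝ) : HasPd (fun _ => c) 0 i x :=
  ⟨differentiableAt_const c, by simp [pd]⟩

lemma HasPd.add {f g : (Fin n → ℝ) → ℝ} {f' g' : ℝ} (hf : HasPd f f' i x) (hg : HasPd g g' i x) :
    HasPd (fun y => f y + g y) (f' + g') i x := by
  refine ⟨hf.1.add hg.1, ?_⟩
  rw [← hf.2, ← hg.2, pd, fderiv_fun_add hf.1 hg.1]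
  rfl

lemma HasPd.sub {f g : (Fin n → ℝ) → ℝ} {f' g' : ℝ} (hf : HasPd f f' i x) (hg : HasPd g g' i x) :
    HasPd (fun y => f y - g y) (f' - g') i x := by
  refine ⟨hf.1.sub hg.1, ?_⟩
  rw [← hf.2, ← hg.2, pd, fderiv_fun_sub hf.1 hg.1]
  rfl

lemma HasPd.mul {f g : (Fin n → ℝ) → ℝ} {f' g' : ℝ} (hf : HasPd f f' i x) (hg : HasPd g g' i x) :
    HasPd (fun y => f y * g y) (f' * g x + f x * g') i x := by
  refine ⟨hf.1.mul hg.1, ?_⟩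
  rw [← hf.2, ← hg.2, pd, fderiv_fun_mul hf.1 hg.1]
  simp [pd]
  ring

lemma HasPd.const_mul {f : (Fin n → ℝ) → ℝ} {f' : ℝ} (c : ℝ) (hf : HasPd f f' i x) :
    HasPd (fun y => c * f y) (c * f') i x := by
  simpa using (hasPd_const c).mul hf

lemma HasPd.sum {ι : Type*} {s : Finset ι} {f : ι → (Fin n → ℝ) → ℝ} {f' : ι → ℝ}
    (hf : ∀ k ∈ s, HasPd (f k) (f' k) i x) :
    HasPd (fun y => ∑ k ∈ s, f k y) (∑ k ∈ s, f' k) i x := by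
  refine ⟨DifferentiableAt.fun_sum fun k hk => (hf k hk).1, ?_⟩
  rw [pd, fderiv_fun_sum fun k hk => (hf k hk).1]
  simp only [sum_apply]
  exact Finset.sum_congr rfl fun k hk => (hf k hk).2

lemma HasPd.log {f : (Fin n → ℝ) → ℝ} {f' : ℝ} (hf : HasPd f f' i x) (h0 : f x ≠ 0) :
    HasPd (fun y => Real.log (f y)) (f' / f x) i x := by
  refine ⟨hf.1.log h0, ?_⟩
  rw [pd, fderiv.log hf.1 h0, ← hf.2]
  simp [pd, div_eq_inv_mul]

/-- Chain rule for `U ∘ ∇Φ`. -/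
lemma hasPd_comp_grad {Φ U : (Fin n → ℝ) → ℝ} (hU : DifferentiableAt ℝ U (grad Φ x))
    (hΦ : ∀ b, DifferentiableAt ℝ (pd Φ b) x) :
    HasPd (fun y => U (grad Φ y)) (∑ b, pd U b (grad Φ x) * pd2 Φ b i x) i x := by
  have hg : HasFDerivAt (grad Φ) (ContinuousLinearMap.pi fun b => fderiv ℝ (pd Φ b) x) x :=
    hasFDerivAt_pi.mpr fun b => (hΦ b).hasFDerivAt
  have hc := hU.hasFDerivAt.comp x hg
  refine ⟨hc.differentiableAt, ?_⟩
  have : pd (fun y => U (grad Φ y)) i x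
      = fderiv ℝ U (grad Φ x) (fun b => pd2 Φ b i x) := by
    rw [pd]
    exact congrArg (fun L => L (Pi.single i 1)) hc.fderiv
  rw [this]
  have hv : (fun b => pd2 Φ b i x) = ∑ b, pd2 Φ b i x • (Pi.single b (1 : ℝ) : Fin n → ℝ) := by
    ext b
    simp [Finset.sum_apply, Pi.single_apply]
  rw [hv, map_sum]
  refine Finset.sum_congr rfl fun b _ => ?_
  rw [map_smul, smul_eq_mul, mul_comm, pd]

variable {M K : (Fin n → ℝ) → Matrix (Fin n) (Fin n) ℝ} {M' K' : Matrix (Fin n) (Fin n) ℝ}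

lemma MatrixHasPd.unique (hM : MatrixHasPd M M' i x) (hK : MatrixHasPd M K' i x) : M' = K' := by
  ext a b
  exact (hM a b).unique (hK a b)

lemma MatrixHasPd.congr {Ω : Set (Fin n → ℝ)} (hM : MatrixHasPd M M' i x) (hΩ : IsOpen Ω)
    (hx : x ∈ Ω) (h : ∀ y ∈ Ω, M y = K y) : MatrixHasPd K M' i x := fun a b =>
  (hM a b).congr hΩ hx fun y hy => by rw [h y hy]

lemma MatrixHasPd.add (hM : MatrixHasPd M M' i x) (hK : MatrixHasPd K K' i x) :
    MatrixHasPd (fun y => M y + K y) (M' + K') i x := fun a b => (hM a b).add (hK a b)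

lemma MatrixHasPd.sub (hM : MatrixHasPd M M' i x) (hK : MatrixHasPd K K' i x) :
    MatrixHasPd (fun y => M y - K y) (M' - K') i x := fun a b => (hM a b).sub (hK a b)

lemma MatrixHasPd.const_smul (c : ℝ) (hM : MatrixHasPd M M' i x) :
    MatrixHasPd (fun y => c • M y) (c • M') i x := fun a b => (hM a b).const_mul c

lemma MatrixHasPd.mul (hM : MatrixHasPd M M' i x) (hK : MatrixHasPd K K' i x) :
    MatrixHasPd (fun y => M y * K y) (M' * K x + M x * K') i x := by
  intro a b
  simp only [Matrix.mul_apply, Matrix.add_apply, ← Finset.sum_add_distrib]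
  exact HasPd.sum fun k _ => (hM a k).mul (hK k b)

lemma MatrixHasPd.trace (hM : MatrixHasPd M M' i x) :
    HasPd (fun y => (M y).trace) M'.trace i x :=
  HasPd.sum fun k _ => hM k k

lemma MatrixHasPd.lin {T : (Fin n → ℝ) → Fin n → Matrix (Fin n) (Fin n) ℝ}
    {T' : Fin n → Matrix (Fin n) (Fin n) ℝ} {u : (Fin n → ℝ) → Fin n → ℝ} {u' : Fin n → ℝ}
    (hT : ∀ m, MatrixHasPd (fun y => T y m) (T' m) i x)
    (hu : ∀ m, HasPd (fun y => u y m) (u' m) i x) :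
    MatrixHasPd (fun y => lin (T y) (u y)) (lin (T x) u' + lin T' (u x)) i x := by
  intro a b
  simp only [_root_.lin, Matrix.sum_apply, Matrix.smul_apply, smul_eq_mul, Matrix.add_apply,
    ← Finset.sum_add_distrib]
  exact HasPd.sum fun m _ => (hu m).mul (hT m a b)

lemma MatrixHasPd.contr {f : (Fin n → ℝ) → Fin n → Fin n → Matrix (Fin n) (Fin n) ℝ}
    {f' : Fin n → Fin n → Matrix (Fin n) (Fin n) ℝ}
    (hM : MatrixHasPd M M' i x)
    (hf : ∀ p q, MatrixHasPd (fun y => f y p q) (f' p q) i x) :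
    MatrixHasPd (fun y => contr (M y) (f y)) (contr M' (f x) + contr (M x) f') i x := by
  intro a b
  simp only [_root_.contr, Matrix.sum_apply, Matrix.smul_apply, smul_eq_mul, Matrix.add_apply,
    ← Finset.sum_add_distrib]
  exact HasPd.sum fun p _ => HasPd.sum fun q _ => (hM p q).mul (hf p q a b)

/-- Jacobi's formula. -/
lemma MatrixHasPd.det (hM : MatrixHasPd M M' i x) :
    HasPd (fun y => (M y).det) ((M x).adjugate * M').trace i x := by
  let D : ContinuousMultilinearMap ℝ (fun _ : Fin n => Fin n → ℝ) ℝ :=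
    { toMultilinearMap := (Matrix.detRowAlternating (R := ℝ) (n := Fin n)).toMultilinearMap
      cont := (continuous_id (X := Matrix (Fin n) (Fin n) ℝ)).matrix_det }
  have hrow : HasFDerivAt (fun y => (fun a b => M y a b : Fin n → Fin n → ℝ))
      (ContinuousLinearMap.pi fun a => ContinuousLinearMap.pi fun b =>
        fderiv ℝ (fun y => M y a b) x) x :=
    hasFDerivAt_pi.mpr fun a => hasFDerivAt_pi.mpr fun b => (hM a b).1.hasFDerivAt
  have hc := (D.hasFDerivAt (x := fun a b => M x a b)).comp x hrow
  refine ⟨hc.differentiableAt, ?_⟩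
  have h1 : pd (fun y => (M y).det) i x
      = D.linearDeriv (fun a b => M x a b) (fun a b => M' a b) := by
    rw [pd]
    refine (congrArg (fun L => L (Pi.single i 1)) hc.fderiv).trans ?_
    have : (fun a b => M' a b) = fun a b => fderiv ℝ (fun y => M y a b) x (Pi.single i 1) := by
      ext a b
      exact (hM a b).2.symm
    rw [this]
    rfl
  rw [h1, ContinuousMultilinearMap.linearDeriv_apply, Matrix.trace_mul_comm, Matrix.trace]
  refine Finset.sum_congr rfl fun k _ => ?_
  have h2 : D (Function.update (fun a b => M x a b) k (fun b => M' k b))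
      = ((M x).updateRow k (M' k)).det := rfl
  rw [h2, ← Matrix.cramer_transpose_apply, Matrix.cramer_eq_adjugate_mulVec,
    ← Matrix.adjugate_transpose, Matrix.mulVec, dotProduct, Matrix.diag_apply, Matrix.mul_apply]
  exact Finset.sum_congr rfl fun j _ => mul_comm _ _

lemma MatrixHasPd.inv {Ω : Set (Fin n → ℝ)} (hΩ : IsOpen Ω) (hx : x ∈ Ω)
    (hM : MatrixHasPd M M' i x) (hu : ∀ y ∈ Ω, IsUnit (M y).det) :
    MatrixHasPd (fun y => (M y)⁻¹) (-((M x)⁻¹ * M' * (M x)⁻¹)) i x := by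
  have hdiff : ∀ a b, DifferentiableAt ℝ (fun y => (M y)⁻¹ a b) x := by
    intro a b
    simp only [Matrix.inv_def, Matrix.smul_apply, Ring.inverse_eq_inv', smul_eq_mul,
      Matrix.adjugate_apply]
    refine (hM.det.1.inv (hu x hx).ne_zero).mul ?_
    refine (MatrixHasPd.det (M := fun y => (M y).updateRow b (Pi.single a 1))
      (M' := M'.updateRow b 0) (i := i) fun c d => ?_).1
    by_cases h : c = b
    · subst h
      simpa using hasPd_const _
    · simpa [Matrix.updateRow_ne h] using hM c d
  obtain ⟨K', hK'⟩ : ∃ K', MatrixHasPd (fun y => (M y)⁻¹) K' i x :=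
    ⟨Matrix.of fun a b => pd (fun y => (M y)⁻¹ a b) i x, fun a b => ⟨hdiff a b, rfl⟩⟩
  have h1 : MatrixHasPd (fun y => (M y)⁻¹ * M y) 0 i x := by
    refine MatrixHasPd.congr (M := fun _ => 1) (fun a b => hasPd_const _) hΩ hx fun y hy => ?_
    rw [Matrix.nonsing_inv_mul _ (hu y hy)]
  have h2 := (hK'.mul hM).unique h1
  have h3 : K' = -((M x)⁻¹ * M' * (M x)⁻¹) := by
    have := congrArg (· * (M x)⁻¹) h2
    simp only [add_mul, mul_assoc, Matrix.mul_nonsing_inv _ (hu x hx), mul_one, zero_mul] at this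
    rw [eq_neg_of_add_eq_zero_left this, mul_assoc]
  rwa [h3] at hK'

end differentiationRules

section hessianMetric

variable {n : ℕ}

/-- The matrices `(Φ_{iab})_{ab}` of third derivatives. -/
def cubic (Φ : (Fin n → ℝ) → ℝ) (x : Fin n → ℝ) (i : Fin n) : Matrix (Fin n) (Fin n) ℝ :=
  Matrix.of fun a b => pd3 Φ i a b x

/-- The matrices `(Φ_{ijab})_{ab}` of fourth derivatives. -/
def quartic (Φ : (Fin n → ℝ) → ℝ) (x : Fin n → ℝ) (i j : Fin n) : Matrix (Fin n) (Fin n) ℝ :=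
  Matrix.of fun a b => pd4 Φ i j a b x

/-- The matrices `(Φ_{ijkab})_{ab}` of fifth derivatives. -/
def quintic (Φ : (Fin n → ℝ) → ℝ) (x : Fin n → ℝ) (i j k : Fin n) : Matrix (Fin n) (Fin n) ℝ :=
  Matrix.of fun a b => pd5 Φ i j k a b x

variable {Ω : Set (Fin n → ℝ)} {Φ : (Fin n → ℝ) → ℝ} {x : Fin n → ℝ}

lemma cubic_swap₁₂ (hΩ : IsOpen Ω) (hΦ : ContDiffOn ℝ 5 Φ Ω) (hx : x ∈ Ω) (i a b : Fin n) :
    cubic Φ x i a b = cubic Φ x a i b :=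
  pd3_swap₁₂ hΩ (hΦ.of_le (by norm_num)) hx i a b

lemma cubic_swap₂₃ (hΩ : IsOpen Ω) (hΦ : ContDiffOn ℝ 5 Φ Ω) (hx : x ∈ Ω) (i a b : Fin n) :
    cubic Φ x i a b = cubic Φ x i b a :=
  pd3_swap₂₃ hΩ (hΦ.of_le (by norm_num)) hx i a b

lemma quartic_swap (hΩ : IsOpen Ω) (hΦ : ContDiffOn ℝ 5 Φ Ω) (hx : x ∈ Ω) (i j : Fin n) :
    quartic Φ x i j = quartic Φ x j i := by
  ext a b
  exact pd4_swap₁₂ hΩ (hΦ.of_le (by norm_num)) hx i j a b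

lemma quartic_swap_pairs (hΩ : IsOpen Ω) (hΦ : ContDiffOn ℝ 5 Φ Ω) (hx : x ∈ Ω)
    (i j a b : Fin n) : quartic Φ x i j a b = quartic Φ x a b i j := by
  have h12 := pd4_swap₁₂ hΩ (hΦ.of_le (by norm_num)) hx
  have h23 := pd4_swap₂₃ hΩ (hΦ.of_le (by norm_num)) hx
  have h34 := pd4_swap₃₄ hΩ (hΦ.of_le (by norm_num)) hx
  change pd4 Φ i j a b x = pd4 Φ a b i j x
  rw [h23, h12, h34, h23]

lemma quartic_transpose (hΩ : IsOpen Ω) (hΦ : ContDiffOn ℝ 5 Φ Ω) (hx : x ∈ Ω) (i j : Fin n) :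
    (quartic Φ x i j).transpose = quartic Φ x i j := by
  ext a b
  exact pd4_swap₃₄ hΩ (hΦ.of_le (by norm_num)) hx i j b a

lemma quintic_rotate (hΩ : IsOpen Ω) (hΦ : ContDiffOn ℝ 5 Φ Ω) (hx : x ∈ Ω) (i j k : Fin n) :
    quintic Φ x i j k = quintic Φ x j k i := by
  ext a b
  have h12 := pd5_swap₁₂ hΩ (hΦ.of_le (by norm_num)) hx
  have h23 := pd5_swap₂₃ hΩ (hΦ.of_le (by norm_num)) hx
  change pd5 Φ i j k a b x = pd5 Φ j k i a b x
  rw [h12, h23]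

lemma ihess_posDef (hpos : (hess Φ x).PosDef) : (ihess Φ x).PosDef := hpos.inv

lemma ihess_symm (hpos : (hess Φ x).PosDef) (p q : Fin n) : ihess Φ x p q = ihess Φ x q p := by
  simpa using ((ihess_posDef hpos).isHermitian.apply p q).symm

lemma ihess_mul_hess (hpos : (hess Φ x).PosDef) : ihess Φ x * hess Φ x = 1 :=
  Matrix.nonsing_inv_mul _ hpos.det_pos.ne'.isUnit

lemma hess_mul_ihess (hpos : (hess Φ x).PosDef) : hess Φ x * ihess Φ x = 1 :=
  Matrix.mul_nonsing_inv _ hpos.det_pos.ne'.isUnit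

lemma matrixHasPd_hess (hΩ : IsOpen Ω) (hΦ : ContDiffOn ℝ 5 Φ Ω) (hx : x ∈ Ω) (q : Fin n) :
    MatrixHasPd (hess Φ) (cubic Φ x q) q x := by
  intro a b
  have h1 := contDiffOn_pd hΩ hΦ (m := 4) (by norm_num) a
  have h2 := contDiffOn_pd hΩ h1 (m := 1) (by norm_num) b
  rw [cubic_swap₁₂ hΩ hΦ hx, cubic_swap₂₃ hΩ hΦ hx]
  exact hasPd_of_contDiffOn hΩ hx h2

lemma matrixHasPd_cubic (hΩ : IsOpen Ω) (hΦ : ContDiffOn ℝ 5 Φ Ω) (hx : x ∈ Ω) (q p : Fin n) :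
    MatrixHasPd (fun y => cubic Φ y p) (quartic Φ x q p) q x := by
  intro a b
  have h1 := contDiffOn_pd hΩ hΦ (m := 4) (by norm_num) p
  have h2 := contDiffOn_pd hΩ h1 (m := 3) (by norm_num) a
  have h3 := contDiffOn_pd hΩ h2 (m := 1) (by norm_num) b
  have h : quartic Φ x q p a b = pd4 Φ p a b q x := by
    rw [quartic_swap hΩ hΦ hx]
    change pd4 Φ p q a b x = _
    rw [pd4_swap₂₃ hΩ (hΦ.of_le (by norm_num)) hx, pd4_swap₃₄ hΩ (hΦ.of_le (by norm_num)) hx]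
  rw [h]
  exact hasPd_of_contDiffOn hΩ hx h3

lemma matrixHasPd_quartic (hΩ : IsOpen Ω) (hΦ : ContDiffOn ℝ 5 Φ Ω) (hx : x ∈ Ω)
    (q p c : Fin n) : MatrixHasPd (fun y => quartic Φ y p c) (quintic Φ x q p c) q x := by
  intro a b
  have h1 := contDiffOn_pd hΩ hΦ (m := 4) (by norm_num) p
  have h2 := contDiffOn_pd hΩ h1 (m := 3) (by norm_num) c
  have h3 := contDiffOn_pd hΩ h2 (m := 2) (by norm_num) a
  have h4 := contDiffOn_pd hΩ h3 (m := 1) (by norm_num) b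
  have h : quintic Φ x q p c a b = pd5 Φ p c a b q x := by
    rw [quintic_rotate hΩ hΦ hx]
    change pd5 Φ p c q a b x = _
    rw [pd5_swap₃₄ hΩ (hΦ.of_le (by norm_num)) hx, pd5_swap₄₅ hΩ hΦ hx]
  rw [h]
  exact hasPd_of_contDiffOn hΩ hx h4

lemma matrixHasPd_ihess (hΩ : IsOpen Ω) (hΦ : ContDiffOn ℝ 5 Φ Ω)
    (hpos : ∀ x ∈ Ω, (hess Φ x).PosDef) (hx : x ∈ Ω) (q : Fin n) :
    MatrixHasPd (ihess Φ) (-(ihess Φ x * cubic Φ x q * ihess Φ x)) q x :=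
  (matrixHasPd_hess hΩ hΦ hx q).inv hΩ hx fun y hy => (hpos y hy).det_pos.ne'.isUnit

/-- The covariant derivative `∇_p Φ_{c··}` of the cubic form, as a matrix. -/
def covariantCubic (Φ : (Fin n → ℝ) → ℝ) (x : Fin n → ℝ) (p c : Fin n) :
    Matrix (Fin n) (Fin n) ℝ :=
  covCubic (ihess Φ x) (cubic Φ x) (quartic Φ x) p c

lemma covariantCubic_transpose (hΩ : IsOpen Ω) (hΦ : ContDiffOn ℝ 5 Φ Ω)
    (hpos : (hess Φ x).PosDef) (hx : x ∈ Ω) (p c : Fin n) :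
    (covariantCubic Φ x p c).transpose = covariantCubic Φ x p c := by
  have hG : (ihess Φ x).transpose = ihess Φ x := by
    ext a b
    exact ihess_symm hpos b a
  have hT : ∀ i, (cubic Φ x i).transpose = cubic Φ x i := fun i => by
    ext a b
    exact cubic_swap₂₃ hΩ hΦ hx i b a
  simp only [covariantCubic, covCubic, lin, Matrix.transpose_sub, Matrix.transpose_smul,
    Matrix.transpose_add, Matrix.transpose_mul, Matrix.transpose_sum, hG, hT,
    quartic_transpose hΩ hΦ hx, mul_assoc]
  rw [add_comm (cubic Φ x c * _)]

lemma matrixHasPd_covariantCubic (hΩ : IsOpen Ω) (hΦ : ContDiffOn ℝ 5 Φ Ω)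
    (hpos : ∀ x ∈ Ω, (hess Φ x).PosDef) (hx : x ∈ Ω) (q p c : Fin n) :
    MatrixHasPd (fun y => covariantCubic Φ y p c)
      (covCubicPd (ihess Φ x) (cubic Φ x) (quartic Φ x) (quintic Φ x) q p c) q x := by
  have hG := matrixHasPd_ihess hΩ hΦ hpos hx q
  have hT := matrixHasPd_cubic hΩ hΦ hx q
  have hsand : ∀ i j, MatrixHasPd (fun y => cubic Φ y i * ihess Φ y * cubic Φ y j)
      (quartic Φ x q i * ihess Φ x * cubic Φ x j
        - cubic Φ x i * ihess Φ x * cubic Φ x q * ihess Φ x * cubic Φ x j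
        + cubic Φ x i * ihess Φ x * quartic Φ x q j) q x := by
    intro i j
    convert ((hT i).mul hG).mul (hT j) using 1
    noncomm_ring
  have hlin := MatrixHasPd.lin hT fun m => (hG.mul (hT p)) m c
  have key := ((matrixHasPd_quartic hΩ hΦ hx q p c).sub
    (((hsand p c).add (hsand c p)).const_smul (1/2))).sub (hlin.const_smul (1/2))
  have hval : -(ihess Φ x * cubic Φ x q * ihess Φ x) * cubic Φ x p + ihess Φ x * quartic Φ x q p
      = ihess Φ x * quartic Φ x q p - ihess Φ x * cubic Φ x q * ihess Φ x * cubic Φ x p := by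
    noncomm_ring
  rw [hval] at key
  exact key

/-- Covariant product rule for the trace form `tr(G M G K)`, `G` being the inverse metric. -/
lemma hasPd_trace_sandwich (hΩ : IsOpen Ω) (hΦ : ContDiffOn ℝ 5 Φ Ω)
    (hpos : ∀ x ∈ Ω, (hess Φ x).PosDef) (hx : x ∈ Ω) {q : Fin n}
    {M K : (Fin n → ℝ) → Matrix (Fin n) (Fin n) ℝ} {M' K' : Matrix (Fin n) (Fin n) ℝ}
    (hM : MatrixHasPd M M' q x) (hK : MatrixHasPd K K' q x) :
    HasPd (fun y => (ihess Φ y * M y * ihess Φ y * K y).trace)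
      ((ihess Φ x * (M' - (1/2 : ℝ) • (cubic Φ x q * ihess Φ x * M x
          + M x * ihess Φ x * cubic Φ x q)) * ihess Φ x * K x).trace
        + (ihess Φ x * M x * ihess Φ x * (K' - (1/2 : ℝ) • (cubic Φ x q * ihess Φ x * K x
          + K x * ihess Φ x * cubic Φ x q))).trace) q x := by
  have hG := matrixHasPd_ihess hΩ hΦ hpos hx q
  convert (((hG.mul hM).mul hG).mul hK).trace using 1
  have hcyc : (ihess Φ x * M x * ihess Φ x * K x * ihess Φ x * cubic Φ x q).trace
      = (ihess Φ x * cubic Φ x q * ihess Φ x * M x * ihess Φ x * K x).trace := by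
    rw [mul_assoc (_ * _), Matrix.trace_mul_comm]
    simp only [mul_assoc]
  simp only [mul_sub, sub_mul, mul_add, add_mul, mul_smul_comm, smul_mul_assoc, Matrix.trace_sub,
    Matrix.trace_add, Matrix.trace_smul, neg_mul, mul_neg, Matrix.trace_neg, ← mul_assoc,
    smul_eq_mul, hcyc]
  ring

lemma christoffel_eq (hΩ : IsOpen Ω) (hΦ : ContDiffOn ℝ 5 Φ Ω) (hx : x ∈ Ω) (k p q : Fin n) :
    Γh Φ k p q x = (1/2) * (ihess Φ x * cubic Φ x p) k q := by
  rw [Γh, Matrix.mul_apply]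
  congr 1
  refine Finset.sum_congr rfl fun m _ => ?_
  rw [cubic_swap₁₂ hΩ hΦ hx]
  rfl

lemma calabi_eq_trace (hΩ : IsOpen Ω) (hΦ : ContDiffOn ℝ 5 Φ Ω)
    (hpos : (hess Φ x).PosDef) (hx : x ∈ Ω) (i j : Fin n) :
    calabi Φ i j x = (ihess Φ x * cubic Φ x i * ihess Φ x * cubic Φ x j).trace := by
  rw [calabi, sum_comm₄]
  simp only [Matrix.trace, Matrix.diag_apply, Matrix.mul_apply, Finset.sum_mul]
  refine Finset.sum_congr rfl fun c _ => Finset.sum_congr rfl fun d _ => ?_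
  rw [Finset.sum_comm]
  refine Finset.sum_congr rfl fun b _ => Finset.sum_congr rfl fun a _ => ?_
  rw [ihess_symm hpos c a, cubic_swap₂₃ hΩ hΦ hx j d c]
  simp only [cubic, Matrix.of_apply]
  ring

lemma trace_sandwich_sub_lin_left (G X K : Matrix (Fin n) (Fin n) ℝ)
    (T : Fin n → Matrix (Fin n) (Fin n) ℝ) (u : Fin n → ℝ) :
    (G * (X - (1/2 : ℝ) • lin T u) * G * K).trace
      = (G * X * G * K).trace - ∑ m, 1/2 * u m * (G * T m * G * K).trace := by
  simp only [lin, mul_sub, sub_mul, Matrix.trace_sub, Finset.smul_sum, Finset.mul_sum,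
    Finset.sum_mul, Matrix.trace_sum, mul_smul_comm, smul_mul_assoc, Matrix.trace_smul,
    smul_eq_mul, mul_assoc]

lemma trace_sandwich_sub_lin_right (G X K : Matrix (Fin n) (Fin n) ℝ)
    (T : Fin n → Matrix (Fin n) (Fin n) ℝ) (u : Fin n → ℝ) :
    (G * K * G * (X - (1/2 : ℝ) • lin T u)).trace
      = (G * K * G * X).trace - ∑ m, 1/2 * u m * (G * K * G * T m).trace := by
  simp only [lin, mul_sub, Matrix.trace_sub, Finset.smul_sum, Finset.mul_sum,
    Matrix.trace_sum, mul_smul_comm, Matrix.trace_smul, smul_eq_mul, mul_assoc]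

lemma covD2_calabi (hΩ : IsOpen Ω) (hΦ : ContDiffOn ℝ 5 Φ Ω)
    (hpos : ∀ x ∈ Ω, (hess Φ x).PosDef) (hx : x ∈ Ω) (p i j : Fin n) :
    covD2 Φ (calabi Φ) p i j x
      = (ihess Φ x * covariantCubic Φ x p i * ihess Φ x * cubic Φ x j).trace
        + (ihess Φ x * cubic Φ x i * ihess Φ x * covariantCubic Φ x p j).trace := by
  have hT := matrixHasPd_cubic hΩ hΦ hx p
  have hpd := (hasPd_trace_sandwich hΩ hΦ hpos hx (hT i) (hT j)).congr hΩ hx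
    (g := calabi Φ i j) fun y hy => (calabi_eq_trace hΩ hΦ (hpos y hy) hy i j).symm
  rw [covD2, hpd.2]
  simp only [christoffel_eq hΩ hΦ hx, calabi_eq_trace hΩ hΦ (hpos x hx) hx]
  simp only [covariantCubic, covCubic, trace_sandwich_sub_lin_left, trace_sandwich_sub_lin_right]
  ring

/-- The second covariant derivative `∇_q∇_p Φ_{c··}` of the cubic form, as a matrix. -/
def covariantCubic₂ (Φ : (Fin n → ℝ) → ℝ) (x : Fin n → ℝ) (q p c : Fin n) :
    Matrix (Fin n) (Fin n) ℝ :=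
  covCubic₂ (ihess Φ x) (cubic Φ x) (quartic Φ x) (quintic Φ x) q p c

lemma covD3_covD2_calabi (hΩ : IsOpen Ω) (hΦ : ContDiffOn ℝ 5 Φ Ω)
    (hpos : ∀ x ∈ Ω, (hess Φ x).PosDef) (hx : x ∈ Ω) (q p i j : Fin n) :
    covD3 Φ (covD2 Φ (calabi Φ)) q p i j x
      = (ihess Φ x * covariantCubic₂ Φ x q p i * ihess Φ x * cubic Φ x j).trace
        + (ihess Φ x * covariantCubic Φ x p i * ihess Φ x * covariantCubic Φ x q j).trace
        + (ihess Φ x * covariantCubic Φ x q i * ihess Φ x * covariantCubic Φ x p j).trace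
        + (ihess Φ x * cubic Φ x i * ihess Φ x * covariantCubic₂ Φ x q p j).trace := by
  have hT := matrixHasPd_cubic hΩ hΦ hx q
  have hN := matrixHasPd_covariantCubic hΩ hΦ hpos hx q p
  have hpd := ((hasPd_trace_sandwich hΩ hΦ hpos hx (hN i) (hT j)).add
    (hasPd_trace_sandwich hΩ hΦ hpos hx (hT i) (hN j))).congr hΩ hx
    (g := covD2 Φ (calabi Φ) p i j) fun y hy => (covD2_calabi hΩ hΦ hpos hy p i j).symm
  rw [covD3, hpd.2]
  simp only [christoffel_eq hΩ hΦ hx, covD2_calabi hΩ hΦ hpos hx]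
  have hfold : covCubic (ihess Φ x) (cubic Φ x) (quartic Φ x) = covariantCubic Φ x := rfl
  have hcov : ∀ c, covariantCubic Φ x q c = quartic Φ x q c
      - (1/2 : ℝ) • (cubic Φ x q * ihess Φ x * cubic Φ x c
        + cubic Φ x c * ihess Φ x * cubic Φ x q)
      - (1/2 : ℝ) • lin (cubic Φ x) (fun m => (ihess Φ x * cubic Φ x q) m c) := fun c => rfl
  simp only [covariantCubic₂, covCubic₂, hfold, trace_sandwich_sub_lin_left,
    trace_sandwich_sub_lin_right]
  rw [hcov i, hcov j]
  simp only [trace_sandwich_sub_lin_left, trace_sandwich_sub_lin_right, mul_add,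
    Finset.sum_add_distrib]
  ring

end hessianMetric

section mongeAmpere

variable {n : ℕ} {Ω : Set (Fin n → ℝ)} {Φ V W : (Fin n → ℝ) → ℝ} {x : Fin n → ℝ}

/-- The matrix `Ŵ_{ab}`. -/
def whatMat (Φ W : (Fin n → ℝ) → ℝ) (x : Fin n → ℝ) : Matrix (Fin n) (Fin n) ℝ :=
  Matrix.of fun a b => What2 Φ W a b x

lemma hess_symm (hpos : (hess Φ x).PosDef) (p q : Fin n) : hess Φ x p q = hess Φ x q p := by
  simpa using (hpos.isHermitian.apply p q).symm

lemma whatMat_eq (hpos : (hess Φ x).PosDef) :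
    whatMat Φ W x = hess Φ x * hess W (grad Φ x) * hess Φ x := by
  ext i j
  simp only [whatMat, What2, Matrix.of_apply, Matrix.mul_apply, Finset.sum_mul]
  rw [Finset.sum_comm]
  refine Finset.sum_congr rfl fun b _ => Finset.sum_congr rfl fun a _ => ?_
  rw [hess_symm hpos i a]
  simp only [hess, Matrix.of_apply]
  ring

lemma differentiableAt_pd (hΩ : IsOpen Ω) (hΦ : ContDiffOn ℝ 5 Φ Ω) (hx : x ∈ Ω) (b : Fin n) :
    DifferentiableAt ℝ (pd Φ b) x :=
  (hasPd_of_contDiffOn (i := b) hΩ hx (contDiffOn_pd hΩ hΦ (by norm_num) b)).1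

lemma hasPd_Wop (hΩ : IsOpen Ω) (hΦ : ContDiffOn ℝ 5 Φ Ω) (hW : ContDiff ℝ 3 W) (hx : x ∈ Ω)
    (a c : Fin n) : HasPd (Wop Φ W a) ((hess W (grad Φ x) * hess Φ x) a c) c x := by
  have h := contDiffOn_pd isOpen_univ hW.contDiffOn (m := 1) (by norm_num) a
  rw [Matrix.mul_apply]
  exact hasPd_comp_grad (hasPd_of_contDiffOn (i := a) isOpen_univ (Set.mem_univ _) h).1
    (differentiableAt_pd hΩ hΦ hx)

lemma log_mongeAmpere (hpos : ∀ x ∈ Ω, (hess Φ x).PosDef)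
    (hMA : ∀ x ∈ Ω, Real.exp (-V x) = Real.exp (-W (grad Φ x)) * (hess Φ x).det) (hx : x ∈ Ω) :
    V x = W (grad Φ x) - Real.log (hess Φ x).det := by
  have h := congrArg Real.log (hMA x hx)
  rw [Real.log_mul (Real.exp_ne_zero _) (hpos x hx).det_pos.ne', Real.log_exp, Real.log_exp] at h
  linarith

/-- First derivative of the Monge–Ampère equation. -/
lemma pd_mongeAmpere (hΩ : IsOpen Ω) (hΦ : ContDiffOn ℝ 5 Φ Ω)
    (hpos : ∀ x ∈ Ω, (hess Φ x).PosDef) (hW : ContDiff ℝ 3 W)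
    (hMA : ∀ x ∈ Ω, Real.exp (-V x) = Real.exp (-W (grad Φ x)) * (hess Φ x).det) (hx : x ∈ Ω)
    (i : Fin n) :
    pd V i x = ∑ a, Wop Φ W a x * hess Φ x a i - (ihess Φ x * cubic Φ x i).trace := by
  have hdet := (hpos x hx).det_pos.ne'
  have hlog := (matrixHasPd_hess hΩ hΦ hx i).det.log hdet
  have hWg : HasPd (fun y => W (grad Φ y)) (∑ a, pd W a (grad Φ x) * pd2 Φ a i x) i x :=
    hasPd_comp_grad (hW.contDiffAt.differentiableAt (by norm_num))
      (differentiableAt_pd hΩ hΦ hx)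
  have h := ((hWg.sub hlog).congr hΩ hx fun y hy => (log_mongeAmpere hpos hMA hy).symm).2
  rw [h, ihess, Matrix.inv_def, Ring.inverse_eq_inv', smul_mul_assoc, Matrix.trace_smul,
    smul_eq_mul, div_eq_inv_mul]
  rfl

/-- Second derivative of the Monge–Ampère equation. -/
lemma hess_mongeAmpere (hΩ : IsOpen Ω) (hΦ : ContDiffOn ℝ 5 Φ Ω)
    (hpos : ∀ x ∈ Ω, (hess Φ x).PosDef) (hW : ContDiff ℝ 3 W)
    (hMA : ∀ x ∈ Ω, Real.exp (-V x) = Real.exp (-W (grad Φ x)) * (hess Φ x).det) (hx : x ∈ Ω) :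
    contr (ihess Φ x) (quartic Φ x)
      = lin (cubic Φ x) (fun a => Wop Φ W a x) + whatMat Φ W x - hess V x
        + contr (ihess Φ x) (fun p q => cubic Φ x p * ihess Φ x * cubic Φ x q) := by
  have h₁ := cubic_swap₁₂ hΩ hΦ hx
  have h₂ := cubic_swap₂₃ hΩ hΦ hx
  have hG := ihess_symm (hpos x hx)
  ext a b
  have hsum : HasPd (fun y => ∑ c, Wop Φ W c y * hess Φ y c a)
      (∑ c, ((hess W (grad Φ x) * hess Φ x) c b * hess Φ x c a
        + Wop Φ W c x * cubic Φ x b c a)) b x :=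
    HasPd.sum fun c _ => (hasPd_Wop hΩ hΦ hW hx c b).mul (matrixHasPd_hess hΩ hΦ hx b c a)
  have htr := ((matrixHasPd_ihess hΩ hΦ hpos hx b).mul (matrixHasPd_cubic hΩ hΦ hx b a)).trace
  have h := ((hsum.sub htr).congr hΩ hx fun y hy =>
    (pd_mongeAmpere hΩ hΦ hpos hW hMA hy a).symm).2
  have hV : hess V x a b = _ := h
  have hquart : (ihess Φ x * quartic Φ x b a).trace = contr (ihess Φ x) (quartic Φ x) a b := by
    simp only [contr, Matrix.trace, Matrix.diag_apply, Matrix.mul_apply, Matrix.sum_apply,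
      Matrix.smul_apply, smul_eq_mul]
    refine Finset.sum_congr rfl fun p _ => Finset.sum_congr rfl fun q _ => ?_
    rw [quartic_swap hΩ hΦ hx b a, quartic_swap_pairs hΩ hΦ hx, quartic_swap hΩ hΦ hx]
  have hcub : (ihess Φ x * cubic Φ x b * ihess Φ x * cubic Φ x a).trace
      = contr (ihess Φ x) (fun p q => cubic Φ x p * ihess Φ x * cubic Φ x q) a b := by
    rw [← trace_cubic hG h₁ h₂, mul_assoc (_ * _), Matrix.trace_mul_comm]
    simp only [mul_assoc]
  have hlin : lin (cubic Φ x) (fun c => Wop Φ W c x) a b = ∑ c, Wop Φ W c x * cubic Φ x b c a := by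
    simp only [lin, Matrix.sum_apply, Matrix.smul_apply, smul_eq_mul]
    exact Finset.sum_congr rfl fun c _ => by rw [h₁ b c a, h₂ c b a]
  have hWm : whatMat Φ W x a b = ∑ c, (hess W (grad Φ x) * hess Φ x) c b * hess Φ x c a := by
    rw [whatMat_eq (hpos x hx), mul_assoc, Matrix.mul_apply]
    exact Finset.sum_congr rfl fun c _ => by rw [hess_symm (hpos x hx) a c, mul_comm]
  rw [Finset.sum_add_distrib, Matrix.trace_add, neg_mul, Matrix.trace_neg, hquart, hcub, ← hlin,
    ← hWm] at hV
  rw [Matrix.add_apply, Matrix.sub_apply, Matrix.add_apply, hV]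
  ring

lemma contr_neg (B : Matrix (Fin n) (Fin n) ℝ) (f : Fin n → Fin n → Matrix (Fin n) (Fin n) ℝ) :
    contr (-B) f = -contr B f := by
  simp [contr]

lemma what3_mat_eq (hW : ContDiff ℝ 3 W) (hpos : (hess Φ x).PosDef) (c : Fin n) :
    (Matrix.of fun a b => What3 Φ W c a b x) = hess Φ x
      * (Matrix.of fun a b => ∑ d, pd3 W a b d (grad Φ x) * pd2 Φ d c x) * hess Φ x := by
  ext a b
  have hW3 : ∀ i j k, pd3 W i j k (grad Φ x) = pd3 W j k i (grad Φ x) := fun i j k => by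
    rw [pd3_swap₁₂ isOpen_univ (hW.of_le (by norm_num)).contDiffOn (Set.mem_univ _),
      pd3_swap₂₃ isOpen_univ hW.contDiffOn (Set.mem_univ _)]
  simp only [What3, Matrix.of_apply, Matrix.mul_apply, Finset.sum_mul, Finset.mul_sum]
  rw [Finset.sum_comm]
  refine (Finset.sum_congr rfl fun l _ => Finset.sum_comm).trans ?_
  rw [Finset.sum_comm]
  refine Finset.sum_congr rfl fun k _ => Finset.sum_congr rfl fun l _ =>
    Finset.sum_congr rfl fun d _ => ?_
  rw [hW3, hess_symm hpos a l]
  simp only [hess, Matrix.of_apply]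
  ring

lemma matrixHasPd_whatMat (hΩ : IsOpen Ω) (hΦ : ContDiffOn ℝ 5 Φ Ω)
    (hpos : ∀ x ∈ Ω, (hess Φ x).PosDef) (hW : ContDiff ℝ 3 W) (hx : x ∈ Ω) (c : Fin n) :
    MatrixHasPd (whatMat Φ W)
      (cubic Φ x c * ihess Φ x * whatMat Φ W x + whatMat Φ W x * ihess Φ x * cubic Φ x c
        + Matrix.of fun a b => What3 Φ W c a b x) c x := by
  have hh := matrixHasPd_hess hΩ hΦ hx c
  have hW2 : MatrixHasPd (fun y => hess W (grad Φ y))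
      (Matrix.of fun a b => ∑ d, pd3 W a b d (grad Φ x) * pd2 Φ d c x) c x := fun a b => by
    have h2 := contDiffOn_pd isOpen_univ (contDiffOn_pd isOpen_univ hW.contDiffOn (m := 2)
      (by norm_num) a) (m := 1) (by norm_num) b
    exact hasPd_comp_grad (hasPd_of_contDiffOn (i := a) isOpen_univ (Set.mem_univ _) h2).1
      (differentiableAt_pd hΩ hΦ hx)
  have key := ((hh.mul hW2).mul hh).congr hΩ hx fun y hy => (whatMat_eq (hpos y hy)).symm
  convert key using 1
  rw [what3_mat_eq hW (hpos x hx), whatMat_eq (hpos x hx)]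
  have e1 : cubic Φ x c * ihess Φ x * (hess Φ x * hess W (grad Φ x) * hess Φ x)
      = cubic Φ x c * hess W (grad Φ x) * hess Φ x := by
    rw [mul_assoc, mul_assoc (hess Φ x), ← mul_assoc (ihess Φ x), ihess_mul_hess (hpos x hx),
      one_mul, mul_assoc]
  have e2 : hess Φ x * hess W (grad Φ x) * hess Φ x * ihess Φ x * cubic Φ x c
      = hess Φ x * hess W (grad Φ x) * cubic Φ x c := by
    rw [mul_assoc (_ * _) _ (ihess Φ x), hess_mul_ihess (hpos x hx), mul_one]
  rw [e1, e2, add_mul]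
  abel

/-- Third derivative of the Monge–Ampère equation. -/
lemma pd3_mongeAmpere (hΩ : IsOpen Ω) (hΦ : ContDiffOn ℝ 5 Φ Ω)
    (hpos : ∀ x ∈ Ω, (hess Φ x).PosDef) (hV : ContDiffOn ℝ 3 V Ω) (hW : ContDiff ℝ 3 W)
    (hMA : ∀ x ∈ Ω, Real.exp (-V x) = Real.exp (-W (grad Φ x)) * (hess Φ x).det) (hx : x ∈ Ω)
    (c : Fin n) :
    contr (ihess Φ x) (fun q p => quintic Φ x q p c)
      = contr (ihess Φ x * cubic Φ x c * ihess Φ x) (quartic Φ x)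
        + lin (fun m => quartic Φ x m c) (fun a => Wop Φ W a x)
        + lin (cubic Φ x) (fun m => (ihess Φ x * whatMat Φ W x) m c)
        + cubic Φ x c * ihess Φ x * whatMat Φ W x + whatMat Φ W x * ihess Φ x * cubic Φ x c
        - Smat Φ V W c x
        - contr (ihess Φ x * cubic Φ x c * ihess Φ x)
            (fun p q => cubic Φ x p * ihess Φ x * cubic Φ x q)
        + contr (ihess Φ x) (fun p q => quartic Φ x p c * ihess Φ x * cubic Φ x q)
        + contr (ihess Φ x) (fun p q => cubic Φ x p * ihess Φ x * quartic Φ x q c)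
        - contr (ihess Φ x)
            (fun p q => cubic Φ x p * ihess Φ x * cubic Φ x c * ihess Φ x * cubic Φ x q) := by
  have hh := matrixHasPd_hess hΩ hΦ hx c
  have hG := matrixHasPd_ihess hΩ hΦ hpos hx c
  have hT : ∀ p, MatrixHasPd (fun y => cubic Φ y p) (quartic Φ x p c) c x := fun p => by
    rw [quartic_swap hΩ hΦ hx]
    exact matrixHasPd_cubic hΩ hΦ hx c p
  have hF : ∀ p q, MatrixHasPd (fun y => quartic Φ y p q) (quintic Φ x p q c) c x :=
    fun p q => by
    rw [← quintic_rotate hΩ hΦ hx]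
    exact matrixHasPd_quartic hΩ hΦ hx c p q
  have hVm : MatrixHasPd (hess V) (Matrix.of fun a b => pd3 V c a b x) c x := by
    intro a b
    have h2 := contDiffOn_pd hΩ (contDiffOn_pd hΩ hV (m := 2) (by norm_num) a) (m := 1)
      (by norm_num) b
    rw [Matrix.of_apply, pd3_swap₁₂ hΩ (hV.of_le (by norm_num)) hx, pd3_swap₂₃ hΩ hV hx]
    exact hasPd_of_contDiffOn hΩ hx h2
  have hWm := matrixHasPd_whatMat hΩ hΦ hpos hW hx c
  have hw : ∀ a, HasPd (fun y => Wop Φ W a y) ((ihess Φ x * whatMat Φ W x) a c) c x := by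
    intro a
    rw [whatMat_eq (hpos x hx), mul_assoc (hess Φ x), ← mul_assoc (ihess Φ x),
      ihess_mul_hess (hpos x hx), one_mul]
    exact hasPd_Wop hΩ hΦ hW hx a c
  have hsand : ∀ p q, MatrixHasPd (fun y => cubic Φ y p * ihess Φ y * cubic Φ y q)
      (quartic Φ x p c * ihess Φ x * cubic Φ x q + cubic Φ x p * ihess Φ x * quartic Φ x q c
        - cubic Φ x p * ihess Φ x * cubic Φ x c * ihess Φ x * cubic Φ x q) c x := by
    intro p q
    convert ((hT p).mul hG).mul (hT q) using 1
    noncomm_ring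
  have hL := hG.contr hF
  have hR := (((MatrixHasPd.lin hT hw).add hWm).sub hVm).add (hG.contr hsand)
  have h := hL.unique (hR.congr hΩ hx fun y hy => (hess_mongeAmpere hΩ hΦ hpos hW hMA hy).symm)
  have hS : Smat Φ V W c x = (Matrix.of fun a b => pd3 V c a b x)
      - Matrix.of fun a b => What3 Φ W c a b x := rfl
  rw [contr_neg, contr_neg, contr_sub, contr_add, neg_add_eq_iff_eq_add] at h
  rw [h, hS]
  abel

end mongeAmpere

section calabiTensor

variable {n : ℕ} {Ω : Set (Fin n → ℝ)} {Φ V W : (Fin n → ℝ) → ℝ} {x : Fin n → ℝ}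

lemma drift_eq (hΩ : IsOpen Ω) (hΦ : ContDiffOn ℝ 5 Φ Ω)
    (hpos : ∀ x ∈ Ω, (hess Φ x).PosDef) (hW : ContDiff ℝ 3 W)
    (hMA : ∀ x ∈ Ω, Real.exp (-V x) = Real.exp (-W (grad Φ x)) * (hess Φ x).det) (hx : x ∈ Ω)
    (m : Fin n) :
    (1/2) * ((∑ k, ihess Φ x m k * pd V k x) + Wop Φ W m x)
      = Wop Φ W m x
        - (1/2) * ∑ q, ∑ p, ihess Φ x q p * (ihess Φ x * cubic Φ x q) m p := by
  have hw : ∑ k, ihess Φ x m k * ∑ a, Wop Φ W a x * hess Φ x a k = Wop Φ W m x := by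
    have h : ∀ k, ihess Φ x m k * ∑ a, Wop Φ W a x * hess Φ x a k
        = ihess Φ x m k * (hess Φ x).mulVec (fun a => Wop Φ W a x) k := fun k => by
      rw [Matrix.mulVec, dotProduct]
      congr 1
      exact Finset.sum_congr rfl fun a _ => by rw [hess_symm (hpos x hx) a k, mul_comm]
    simp only [h]
    change (ihess Φ x).mulVec ((hess Φ x).mulVec fun a => Wop Φ W a x) m = _
    rw [Matrix.mulVec_mulVec, ihess_mul_hess (hpos x hx), Matrix.one_mulVec]
  have htr : ∑ k, ihess Φ x m k * (ihess Φ x * cubic Φ x k).trace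
      = ∑ q, ∑ p, ihess Φ x q p * (ihess Φ x * cubic Φ x q) m p := by
    simp only [Matrix.trace, Matrix.diag_apply, Matrix.mul_apply, Finset.mul_sum]
    rw [Finset.sum_comm]
    refine Finset.sum_congr rfl fun q _ => ?_
    rw [Finset.sum_comm]
    refine Finset.sum_congr rfl fun p _ => Finset.sum_congr rfl fun k _ => ?_
    rw [cubic_swap₂₃ hΩ hΦ hx k p q, cubic_swap₁₂ hΩ hΦ hx k q p]
    ring
  simp only [pd_mongeAmpere hΩ hΦ hpos hW hMA hx, mul_sub, Finset.sum_sub_distrib, hw, htr]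
  ring

/-- The weighted Laplacian of the cubic form, as a matrix. -/
def laplacianCubic (Φ W : (Fin n → ℝ) → ℝ) (x : Fin n → ℝ) (c : Fin n) :
    Matrix (Fin n) (Fin n) ℝ :=
  contr (ihess Φ x) (fun q p => covariantCubic₂ Φ x q p c)
    - lin (fun p => covariantCubic Φ x p c) (fun m => Wop Φ W m x
      - (1/2) * ∑ q, ∑ p, ihess Φ x q p * (ihess Φ x * cubic Φ x q) m p)

/-- Leibniz rule for the weighted Laplacian of the Calabi tensor. -/
lemma LT2_calabi (hΩ : IsOpen Ω) (hΦ : ContDiffOn ℝ 5 Φ Ω)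
    (hpos : ∀ x ∈ Ω, (hess Φ x).PosDef) (hW : ContDiff ℝ 3 W)
    (hMA : ∀ x ∈ Ω, Real.exp (-V x) = Real.exp (-W (grad Φ x)) * (hess Φ x).det) (hx : x ∈ Ω)
    (i j : Fin n) :
    LT2 Φ V W (calabi Φ) i j x
      = (ihess Φ x * laplacianCubic Φ W x i * ihess Φ x * cubic Φ x j).trace
        + (ihess Φ x * cubic Φ x i * ihess Φ x * laplacianCubic Φ W x j).trace
        + 2 * ∑ p, ∑ q, ihess Φ x p q
          * (ihess Φ x * covariantCubic Φ x p i * ihess Φ x * covariantCubic Φ x q j).trace := by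
  have hleft : ∀ (f : Fin n → Fin n → Matrix (Fin n) (Fin n) ℝ)
      (N : Fin n → Matrix (Fin n) (Fin n) ℝ) (u : Fin n → ℝ) (K : Matrix (Fin n) (Fin n) ℝ),
      (ihess Φ x * (contr (ihess Φ x) f - lin N u) * ihess Φ x * K).trace
        = ∑ p, ∑ q, ihess Φ x p q * (ihess Φ x * f p q * ihess Φ x * K).trace
          - ∑ p, u p * (ihess Φ x * N p * ihess Φ x * K).trace := fun f N u K => by
    simp only [contr, lin, mul_sub, sub_mul, Matrix.trace_sub, Finset.mul_sum, Finset.sum_mul,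
      Matrix.trace_sum, mul_smul_comm, smul_mul_assoc, Matrix.trace_smul, smul_eq_mul]
  have hright : ∀ (f : Fin n → Fin n → Matrix (Fin n) (Fin n) ℝ)
      (N : Fin n → Matrix (Fin n) (Fin n) ℝ) (u : Fin n → ℝ) (K : Matrix (Fin n) (Fin n) ℝ),
      (ihess Φ x * K * ihess Φ x * (contr (ihess Φ x) f - lin N u)).trace
        = ∑ p, ∑ q, ihess Φ x p q * (ihess Φ x * K * ihess Φ x * f p q).trace
          - ∑ p, u p * (ihess Φ x * K * ihess Φ x * N p).trace := fun f N u K => by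
    simp only [contr, lin, mul_sub, Matrix.trace_sub, Finset.mul_sum,
      Matrix.trace_sum, mul_smul_comm, Matrix.trace_smul, smul_eq_mul]
  have hswap : ∑ p, ∑ q, ihess Φ x p q
        * (ihess Φ x * covariantCubic Φ x q i * ihess Φ x * covariantCubic Φ x p j).trace
      = ∑ p, ∑ q, ihess Φ x p q
        * (ihess Φ x * covariantCubic Φ x p i * ihess Φ x * covariantCubic Φ x q j).trace := by
    rw [Finset.sum_comm]
    simp only [ihess_symm (hpos x hx)]
  rw [LT2, Finset.mul_sum]
  simp only [← mul_assoc (1/2 : ℝ) (_ + _), drift_eq hΩ hΦ hpos hW hMA hx,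
    covD3_covD2_calabi hΩ hΦ hpos hx, covD2_calabi hΩ hΦ hpos hx]
  rw [laplacianCubic, laplacianCubic, hleft, hright]
  simp only [mul_add, Finset.sum_add_distrib, hswap]
  ring

lemma Smat_transpose (hΩ : IsOpen Ω) (hV : ContDiffOn ℝ 3 V Ω) (hW : ContDiff ℝ 3 W)
    (hx : x ∈ Ω) (i : Fin n) : (Smat Φ V W i x).transpose = Smat Φ V W i x := by
  ext a b
  simp only [Smat, Matrix.transpose_apply, Matrix.of_apply]
  rw [pd3_swap₂₃ hΩ hV hx]
  congr 1
  simp only [What3]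
  refine Finset.sum_congr rfl fun c _ => ?_
  rw [Finset.sum_comm]
  refine Finset.sum_congr rfl fun k _ => Finset.sum_congr rfl fun l _ => ?_
  rw [pd3_swap₂₃ isOpen_univ hW.contDiffOn (Set.mem_univ _)]
  ring

end calabiTensor

/-- the matrix `H + 2Lg − (V+Ŵ)'' Φ⁻¹ g − g Φ⁻¹ (V+Ŵ)'' − g Φ⁻¹ g`
is positive semidefinite. -/
theorem stmt_12 {n : ℕ} (Ω : Set (Fin n → ℝ)) (hΩ : IsOpen Ω)
    (Φ V W : (Fin n → ℝ) → ℝ)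
    (hΦ : ContDiffOn ℝ 5 Φ Ω) (hΦconv : ConvexOn ℝ Ω Φ)
    (hpos : ∀ x ∈ Ω, (hess Φ x).PosDef)
    (hV : ContDiffOn ℝ 3 V Ω) (hW : ContDiff ℝ 3 W)
    (hMA : ∀ x ∈ Ω, Real.exp (-V x) = Real.exp (-W (grad Φ x)) * (hess Φ x).det)
    (hA : ∀ x ∈ Ω, (Amat Φ V W x).PosDef) :
    ∀ x ∈ Ω, ∀ v : Fin n → ℝ,
      0 ≤ ∑ i, ∑ j,
        (Hten Φ V W i j x + 2 * LT2 Φ V W (calabi Φ) i j x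
          - (∑ s, ∑ m, (pd2 V i s x + What2 Φ W i s x) * ihess Φ x s m * calabi Φ m j x)
          - (∑ s, ∑ m, (pd2 V j s x + What2 Φ W j s x) * ihess Φ x s m * calabi Φ m i x)
          - (∑ k, ∑ m, calabi Φ k i x * ihess Φ x k m * calabi Φ m j x)) * v i * v j := by
  intro x hx v
  have h₁ := cubic_swap₁₂ hΩ hΦ hx
  have h₂ := cubic_swap₂₃ hΩ hΦ hx
  have hG := ihess_symm (hpos x hx)
  have hJ := fun c => weighted_laplacian_cubic hG h₁ h₂
    (hess_mongeAmpere hΩ hΦ hpos hW hMA hx) (S := fun c => Smat Φ V W c x) c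
    (pd3_mongeAmpere hΩ hΦ hpos hV hW hMA hx c)
  have key := quadratic_form_nonneg (ihess_posDef (hpos x hx)) (hA x hx) h₁ h₂
    (Smat_transpose hΩ hV hW hx) (covariantCubic_transpose hΩ hΦ (hpos x hx) hx)
    (J := laplacianCubic Φ W x) hJ v
  have hcal : ∀ i j, calabi Φ i j x
      = contr (ihess Φ x) (fun p q => cubic Φ x p * ihess Φ x * cubic Φ x q) i j := fun i j =>
    (calabi_eq_trace hΩ hΦ (hpos x hx) hx i j).trans (trace_cubic hG h₁ h₂ i j)
  have hcal_symm : ∀ i j, calabi Φ i j x = calabi Φ j i x := fun i j => by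
    rw [calabi_eq_trace hΩ hΦ (hpos x hx) hx, calabi_eq_trace hΩ hΦ (hpos x hx) hx,
      mul_assoc (_ * _), Matrix.trace_mul_comm]
    simp only [mul_assoc]
  have hmul : ∀ (B : Matrix (Fin n) (Fin n) ℝ) (i j : Fin n),
      ∑ s, ∑ m, B i s * ihess Φ x s m * calabi Φ m j x = (B * ihess Φ x
        * contr (ihess Φ x) (fun p q => cubic Φ x p * ihess Φ x * cubic Φ x q)) i j := by
    intro B i j
    rw [Finset.sum_comm, Matrix.mul_apply]
    exact Finset.sum_congr rfl fun m _ => by rw [Matrix.mul_apply, Finset.sum_mul, ← hcal]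
  refine key.trans_eq (Finset.sum_congr rfl fun i _ => Finset.sum_congr rfl fun j _ => ?_)
  have hgg := hmul (Matrix.of fun i j => calabi Φ i j x) i j
  have hgm : (Matrix.of fun i j => calabi Φ i j x)
      = contr (ihess Φ x) (fun p q => cubic Φ x p * ihess Φ x * cubic Φ x q) := by
    ext a b
    exact hcal a b
  rw [hgm] at hgg
  rw [← LT2_calabi hΩ hΦ hpos hW hMA hx, ← hmul, ← hmul, ← hgg]
  simp only [← hcal, hcal_symm i]
  rfl
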